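/- Let d ≥ 2 divide q−1, let v_1,…,v_k be distinct elements of F_q, and let M be the number of x in F_q such that (x−v_i)^{(q−1)/d} = 1 for all i = 1,…,k. Then |M − q/d^k| ≤ k√q. -/

import Mathlib

section
open Polynomial

theorem wb_coeff_zero_pow {K : Type*} [Field K] (b : K) (d : ℕ) (P : K[X]) (hP : P.Monic)
    (hdvd : P ∣ X ^ d - C b) :
    (P.coeff 0) ^ d = ((-1) ^ P.natDegree) ^ d * b ^ P.natDegree := by
  have hsp : (P.map (algebraMap K (AlgebraicClosure K))).Splits := IsAlgClosed.splits _
  apply (algebraMap K (AlgebraicClosure K)).injective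
  have h1 := hsp.coeff_zero_eq_prod_roots_of_monic (hP.map _)
  rw [coeff_map, natDegree_map] at h1
  rw [map_pow, h1, mul_pow, map_mul, map_pow, map_pow, map_pow, map_neg, map_one]
  congr 1
  have hcard := hsp.natDegree_eq_card_roots
  rw [natDegree_map] at hcard
  have hpw : ∀ t : Multiset (AlgebraicClosure K), t.prod ^ d = (t.map (fun y => y ^ d)).prod := by
    intro t
    rw [Multiset.prod_map_pow, Multiset.map_id']
  rw [hcard, hpw, ← Multiset.prod_replicate, ← Multiset.map_const']
  congr 1
  apply Multiset.map_congr rfl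
  intro y hy
  have hr := (mem_roots'.1 hy).2
  have h2 : (X ^ d - C b : K[X]).map (algebraMap K (AlgebraicClosure K)) |>.IsRoot y :=
    hr.dvd (Polynomial.map_dvd _ hdvd)
  simp [IsRoot, sub_eq_zero] at h2
  exact h2

theorem wb_irred {E : Type*} [Field E] (f : E[X]) (hf : f ≠ 0) (d : ℕ) (hd : 0 < d)
    (hg : ∀ m : ℕ, (∀ x : E, d ∣ m * f.rootMultiplicity x) → d ∣ m) (c : E) (hc : c ≠ 0)  :
    Irreducible (X ^ d - C (algebraMap E[X] (FractionRing E[X]) (C c) /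
      algebraMap E[X] (FractionRing E[X]) f) : (FractionRing E[X])[X]) := by
  classical
  set K := FractionRing E[X]
  set b : K := algebraMap E[X] K (C c) / algebraMap E[X] K f with hb
  have hinj : Function.Injective (algebraMap E[X] K) := IsFractionRing.injective _ _
  have hfK : algebraMap E[X] K f ≠ 0 := by
    intro h; exact hf (hinj (by simpa using h))
  have hmon : (X ^ d - C b : K[X]).Monic := monic_X_pow_sub_C b hd.ne'
  have hnd : (X ^ d - C b : K[X]).natDegree = d := natDegree_X_pow_sub_C
  have hnu : ¬ IsUnit (X ^ d - C b : K[X]) := by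
    intro h
    have := natDegree_eq_zero_of_isUnit h
    omega
  obtain ⟨P, hPm, hPi, hPd⟩ := exists_monic_irreducible_factor _ hnu
  have hm := wb_coeff_zero_pow b d P hPm hPd
  have hdm : d ∣ P.natDegree := by
    apply hg
    intro x
    obtain ⟨u, w, hw, huw⟩ := IsFractionRing.div_surjective (A := E[X]) (P.coeff 0)
    have hw0 : w ≠ 0 := nonZeroDivisors.ne_zero hw
    have hwK : algebraMap E[X] K w ≠ 0 := by
      intro h; exact hw0 (hinj (by simpa using h))
    rw [← huw, hb, div_pow, div_pow, ← mul_div_assoc, div_eq_div_iff (pow_ne_zero _ hwK) (pow_ne_zero _ hfK)] at hm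
    have hm2 : u ^ d * f ^ P.natDegree = ((-1) ^ P.natDegree) ^ d * (C c) ^ P.natDegree * w ^ d := by
      apply hinj
      simpa using hm
    have hcon : ((-1) ^ P.natDegree) ^ d * (C c) ^ P.natDegree = C (((-1) ^ P.natDegree) ^ d * c ^ P.natDegree : E) := by
      simp
    rw [hcon] at hm2
    have hc' : (((-1) ^ P.natDegree) ^ d * c ^ P.natDegree : E) ≠ 0 := by
      apply mul_ne_zero _ (pow_ne_zero _ hc)
      apply pow_ne_zero; apply pow_ne_zero; simp
    have hu0 : u ≠ 0 := by
      rintro rfl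
      rw [zero_pow hd.ne', zero_mul] at hm2
      have := hm2.symm
      simp [hw0] at this
      tauto
    have h3 := congrArg (rootMultiplicity x) hm2
    rw [rootMultiplicity_mul (mul_ne_zero (pow_ne_zero _ hu0) (pow_ne_zero _ hf)),
      rootMultiplicity_mul (mul_ne_zero (C_ne_zero.2 hc') (pow_ne_zero _ hw0)), rootMultiplicity_C, zero_add] at h3
    simp only [← count_roots, roots_pow, Multiset.count_nsmul] at h3
    simp only [count_roots] at h3
    rw [← (Nat.dvd_add_right (Dvd.intro _ rfl : d ∣ d * u.rootMultiplicity x)), h3]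
    exact Dvd.intro _ rfl
  have hP0 : 0 < P.natDegree := hPi.natDegree_pos
  have := eq_of_monic_of_dvd_of_natDegree_le hPm hmon hPd (by rw [hnd]; exact Nat.le_of_dvd hP0 hdm)
  rwa [this]

theorem wb_row {R : Type*} [CommRing R] (d : ℕ) (A : Fin d → R) (f c g : R) (h : f * g ^ d = c)
    (i : Fin d) :
    ∑ m : Fin d, (∑ l : Fin d, A l * (if (l : ℕ) + i = m then f else if (l : ℕ) + i = m + d then c else 0))
      * g ^ (m : ℕ) = f * g ^ (i : ℕ) * ∑ l : Fin d, A l * g ^ (l : ℕ) := by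
  simp only [Finset.sum_mul]
  rw [Finset.sum_comm, Finset.mul_sum]
  refine Finset.sum_congr rfl fun l _ => ?_
  by_cases hl : (l : ℕ) + i < d
  · rw [Finset.sum_eq_single ⟨l + i, hl⟩]
    · simp; ring
    · intro m _ hm
      rw [if_neg, if_neg]
      · simp
      · omega
      · intro h; apply hm; ext; simp [h]
    · simp
  · rw [Finset.sum_eq_single ⟨l + i - d, by omega⟩]
    · rw [if_neg (by simp; omega), if_pos (by simp; omega)]
      simp only
      rw [← h]
      have : g ^ d * g ^ ((l : ℕ) + i - d) = g ^ (l : ℕ) * g ^ (i : ℕ) := by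
        rw [← pow_add, ← pow_add]; congr 1; omega
      linear_combination (A l * f) * this
    · intro m _ hm
      rw [if_neg, if_neg]
      · simp
      · intro h; apply hm; ext; simp; omega
      · omega
    · simp

end

section
open Polynomial

theorem wb_lin_zero {E : Type*} [Field E] {K : Type*} [Field K] [Algebra E[X] K]
    (hinj : Function.Injective (algebraMap E[X] K)) (d : ℕ) (hd : 0 < d) (b : K)
    (V : Fin d → E[X])
    (h : ∑ l : Fin d, algebraMap K (AdjoinRoot (X ^ d - C b)) (algebraMap E[X] K (V l)) *
      (AdjoinRoot.root (X ^ d - C b)) ^ (l : ℕ) = 0) : V = 0 := by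
  have hnd : (X ^ d - C b : K[X]).degree = d := degree_X_pow_sub_C hd b
  set P : K[X] := ∑ l : Fin d, C (algebraMap E[X] K (V l)) * X ^ (l : ℕ) with hP
  have hPdeg : P.degree < d := by
    exact degree_sum_fin_lt _
  have hmk : AdjoinRoot.mk (X ^ d - C b) P = 0 := by
    rw [hP, map_sum, ← h]
    refine Finset.sum_congr rfl fun l _ => ?_
    simp [AdjoinRoot.algebraMap_eq]
  rw [AdjoinRoot.mk_eq_zero] at hmk
  have hP0 : P = 0 := by
    by_contra hne
    have := degree_le_of_dvd hmk hne
    rw [hnd] at this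
    exact absurd hPdeg (not_lt.2 this)
  funext l
  apply hinj
  have := congrArg (fun Q => coeff Q l) hP0
  simp only [hP, finsetSum_coeff, coeff_C_mul, coeff_X_pow, coeff_zero] at this
  rw [Finset.sum_eq_single l] at this
  · simpa using this
  · intro m _ hm
    rw [if_neg, mul_zero]
    intro h; exact hm (Fin.ext h.symm)
  · simp

theorem wb_key {E : Type*} [Field E] (p n : ℕ) [Fact p.Prime] [CharP E p] (s d e a D : ℕ)
    (hsp : s = p ^ n) (hs : d * e + 1 = s) (hd : 0 < d) (f : E[X]) (hf0 : f.eval 0 ≠ 0)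
    (hg : ∀ m : ℕ, (∀ x : E, d ∣ m * f.rootMultiplicity x) → d ∣ m)
    (hD : f.natDegree ≤ D) (A : Fin d → E[X]) (hA : ∀ l, (A l).natDegree ≤ a)
    (hdeg : d * (a + D) < s) (h : X ^ s ∣ ∑ l : Fin d, A l * (f ^ e) ^ (l : ℕ)) : A = 0 := by
  classical
  have hf : f ≠ 0 := by rintro rfl; simp at hf0
  set c : E := (f.eval 0) ^ s with hc
  have hc0 : c ≠ 0 := pow_ne_zero _ hf0
  let M : Matrix (Fin d) (Fin d) E[X] := fun i m =>
    ∑ l : Fin d, A l * (if (l : ℕ) + i = m then f else if (l : ℕ) + i = m + d then C c else 0)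
  have hMdeg : ∀ i m, (M i m).natDegree ≤ a + D := by
    intro i m
    refine natDegree_sum_le_of_forall_le _ _ fun l _ => ?_
    refine natDegree_mul_le.trans (add_le_add (hA l) ?_)
    split_ifs
    · exact hD
    · simp
    · simp
  have hdetdeg : M.det.natDegree ≤ d * (a + D) := by
    rw [Matrix.det_apply]
    refine natDegree_sum_le_of_forall_le _ _ fun σ _ => ?_
    refine (natDegree_smul_le _ _).trans ?_
    refine (natDegree_prod_le _ _).trans ?_
    refine (Finset.sum_le_sum fun i _ => hMdeg _ _).trans ?_
    simp
  -- step 1: X^s divides det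
  have hdvd : X ^ s ∣ M.det := by
    let q := Ideal.Quotient.mk (Ideal.span {(X ^ s : E[X])})
    have hq : ∀ t, q t = 0 ↔ X ^ s ∣ t := by
      intro t
      rw [Ideal.Quotient.eq_zero_iff_mem, Ideal.mem_span_singleton]
    rw [← hq, RingHom.map_det]
    have hrel : q f * (q (f ^ e)) ^ d = q (C c) := by
      rw [← map_pow, ← map_mul, ← sub_eq_zero, ← map_sub, hq]
      have : f * (f ^ e) ^ d - C c = (f - C (f.eval 0)) ^ s := by
        rw [hsp, sub_pow_char_pow, ← hsp, ← pow_mul, ← pow_succ', mul_comm e d, hs, hc, map_pow]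
      rw [this]
      apply pow_dvd_pow_of_dvd
      rw [X_dvd_iff, coeff_zero_eq_eval_zero]
      simp
    have hrow := wb_row d (fun l => q (A l)) (q f) (q (C c)) (q (f ^ e)) hrel
    have hsum : ∑ l : Fin d, q (A l) * (q (f ^ e)) ^ (l : ℕ) = 0 := by
      rw [← (hq _).2 h]
      simp
    have hmv : (q.mapMatrix M).mulVec (fun m : Fin d => (q (f ^ e)) ^ (m : ℕ)) = 0 := by
      funext i
      have := hrow i
      rw [hsum, mul_zero] at this
      rw [Pi.zero_apply, ← this]
      have hM : ∀ m, q.mapMatrix M i m = q (M i m) := fun m => rfl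
      simp only [Matrix.mulVec, dotProduct, hM]
      simp only [M, map_sum, map_mul, apply_ite q, map_zero]
    have h2 := congrArg (fun w => (q.mapMatrix M).adjugate.mulVec w) hmv
    simp only [Matrix.mulVec_mulVec, Matrix.adjugate_mul, Matrix.mulVec_zero] at h2
    have h3 := congrFun h2 ⟨0, hd⟩
    simpa [Matrix.smul_mulVec] using h3
  have hdet0 : M.det = 0 := by
    by_contra hne
    have := natDegree_le_of_dvd hdvd hne
    rw [natDegree_X_pow] at this
    omega
  obtain ⟨B, hB, hBM⟩ := Matrix.exists_vecMul_eq_zero_iff.2 hdet0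
  set K := FractionRing E[X]
  have hinj : Function.Injective (algebraMap E[X] K) := IsFractionRing.injective _ _
  have hfK : algebraMap E[X] K f ≠ 0 := by
    intro h; exact hf (hinj (by simpa using h))
  have hirr := wb_irred f hf d hd hg c hc0
  set b : K := algebraMap E[X] K (C c) / algebraMap E[X] K f with hb
  have : Fact (Irreducible (X ^ d - C b : K[X])) := ⟨hirr⟩
  let L := AdjoinRoot (X ^ d - C b : K[X])
  let φ : E[X] →+* L := (algebraMap K L).comp (algebraMap E[X] K)
  let θ : L := AdjoinRoot.root (X ^ d - C b : K[X])
  have hθ : θ ^ d = algebraMap K L b := by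
    have := AdjoinRoot.eval₂_root (X ^ d - C b : K[X])
    simp only [eval₂_sub, eval₂_pow, eval₂_X, eval₂_C, sub_eq_zero] at this
    exact this
  have hφf : φ f ≠ 0 := by
    intro h
    exact hfK ((algebraMap K L).injective (by simpa [φ] using h))
  have hrel : φ f * θ ^ d = φ (C c) := by
    rw [hθ]
    simp only [φ, RingHom.comp_apply]
    have hbb : algebraMap E[X] K f * b = algebraMap E[X] K (C c) := mul_div_cancel₀ _ hfK
    rw [← map_mul, hbb]
  have hrow := wb_row d (fun l => φ (A l)) (φ f) (φ (C c)) θ hrel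
  have hprod : φ f * ((∑ i : Fin d, φ (B i) * θ ^ (i : ℕ)) * (∑ l : Fin d, φ (A l) * θ ^ (l : ℕ))) = 0 := by
    have h1 : φ f * ((∑ i : Fin d, φ (B i) * θ ^ (i : ℕ)) * (∑ l : Fin d, φ (A l) * θ ^ (l : ℕ)))
        = ∑ i : Fin d, φ (B i) * (φ f * θ ^ (i : ℕ) * ∑ l : Fin d, φ (A l) * θ ^ (l : ℕ)) := by
      rw [Finset.sum_mul, Finset.mul_sum]
      refine Finset.sum_congr rfl fun i _ => ?_
      ring
    rw [h1]
    have h2 : ∀ i : Fin d, φ (B i) * (φ f * θ ^ (i : ℕ) * ∑ l : Fin d, φ (A l) * θ ^ (l : ℕ)) =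
        ∑ m : Fin d, φ (B i * M i m) * θ ^ (m : ℕ) := by
      intro i
      rw [← hrow i, Finset.mul_sum]
      refine Finset.sum_congr rfl fun m _ => ?_
      simp only [M, map_mul, map_sum, apply_ite φ, map_zero]
      ring
    rw [Finset.sum_congr rfl fun i _ => h2 i, Finset.sum_comm]
    refine Finset.sum_eq_zero fun m _ => ?_
    rw [← Finset.sum_mul, ← map_sum]
    have := congrFun hBM m
    simp only [Matrix.vecMul, dotProduct] at this
    rw [this]; simp
  rcases mul_eq_zero.1 ((mul_eq_zero.1 hprod).resolve_left hφf) with h0 | h0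
  · exact absurd (wb_lin_zero hinj d hd b B h0) hB
  · exact wb_lin_zero hinj d hd b A h0

end

section
open Polynomial

theorem wb_shift {E : Type*} [Field E] (s J : ℕ) (H : Fin J → E[X])
    (hH : ∀ j, X ^ s ∣ H j → H j = 0) (hsum : ∑ j : Fin J, X ^ ((j : ℕ) * s) * H j = 0) :
    ∀ j, H j = 0 := by
  suffices h : ∀ N : ℕ, ∀ j : Fin J, (j : ℕ) = N → H j = 0 from fun j => h j j rfl
  intro N
  induction N using Nat.strong_induction_on with
  | _ N ih =>
    intro j hj
    apply hH
    have h1 : X ^ (N * s + s) ∣ X ^ (N * s) * H j := by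
      rw [← Finset.add_sum_erase _ _ (Finset.mem_univ j)] at hsum
      rw [← hj, eq_neg_of_add_eq_zero_left hsum, dvd_neg]
      refine Finset.dvd_sum fun i hi => ?_
      have hij : (i : ℕ) ≠ j := fun h => (Finset.ne_of_mem_erase hi) (Fin.ext h)
      rcases lt_or_gt_of_ne hij with h | h
      · rw [ih i (by omega) i rfl]; simp
      · apply Dvd.dvd.mul_right
        apply pow_dvd_pow
        calc (j : ℕ) * s + s = (j + 1) * s := by ring
          _ ≤ i * s := Nat.mul_le_mul_right _ h
    rw [pow_add] at h1
    exact (mul_dvd_mul_iff_left (pow_ne_zero _ X_ne_zero)).1 h1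

theorem wb_stepanov {E : Type*} [Field E] [Fintype E] [DecidableEq E] (p n : ℕ) [Fact p.Prime]
    [CharP E p] (s d e D : ℕ)
    (hsp : s = p ^ n) (hs : d * e + 1 = s) (hd : 2 ≤ d) (hcard : Fintype.card E = s ^ 2)
    (f : E[X]) (hf0 : f.eval 0 ≠ 0)
    (hg : ∀ m : ℕ, (∀ x : E, d ∣ m * f.rootMultiplicity x) → d ∣ m)
    (hD : f.natDegree ≤ D) (he : 6 * D + 4 < e) (ζ : E) (hζ : ζ ≠ 0) :
    (Finset.univ.filter (fun x : E => (f.eval x) ^ (e * (s + 1)) = ζ)).card ≤ s * (e + 3 * D + 3) := by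
  obtain ⟨a, ha⟩ : ∃ a, a + D = e := ⟨e - D, by omega⟩
  set J := e + 2 * D + 2 with hJ
  set L := a * s + J + D * s with hL
  have hed : e * (d - 1) ≤ s := by
    rw [← hs, mul_comm d e]
    exact (Nat.mul_le_mul_left e (Nat.sub_le d 1)).trans (Nat.le_succ _)
  let ι := Fin d × Fin J × Fin a
  let w : ι → E[X] := fun t => C (ζ ^ (t.1 : ℕ)) * X ^ ((t.2.2 : ℕ) * s + t.2.1) * f ^ (e * (d - 1 - t.1))
  have hfdeg : ∀ l : ℕ, l ≤ d - 1 → (f ^ (e * l)).natDegree ≤ D * s := by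
    intro l hl
    refine natDegree_pow_le.trans ?_
    rw [mul_comm]
    exact Nat.mul_le_mul hD ((Nat.mul_le_mul_left e hl).trans hed)
  have hw : ∀ t, (w t).natDegree < L := by
    intro t
    have h1 : (w t).natDegree ≤ ((t.2.2 : ℕ) * s + t.2.1) + D * s := by
      refine natDegree_mul_le.trans (add_le_add ?_ (hfdeg _ (by omega)))
      exact natDegree_C_mul_X_pow_le _ _
    have h2 : (t.2.2 : ℕ) * s ≤ a * s := Nat.mul_le_mul_right _ t.2.2.2.le
    have h3 := t.2.1.2
    omega
  let Φ : (ι → E) →ₗ[E] (Fin L → E) :=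
    { toFun := fun β k => ∑ t, β t * (w t).coeff k
      map_add' := by
        intro x y; funext k; simp [add_mul, Finset.sum_add_distrib]
      map_smul' := by
        intro r x; funext k; simp [Finset.mul_sum, mul_assoc] }
  have hdim : L < d * (J * a) := by
    rw [hL, hJ, ← hs]
    obtain ⟨r, rfl⟩ : ∃ r, d = r + 2 := ⟨d - 2, by omega⟩
    subst ha
    have h5 : 5 * D + 4 < a := by omega
    nlinarith [Nat.zero_le (r * a * D), Nat.zero_le (r * D * D), Nat.zero_le (r * a), mul_le_mul h5.le (le_refl (r * D)) (Nat.zero_le _) (Nat.zero_le _), mul_le_mul h5.le (le_refl D) (Nat.zero_le _) (Nat.zero_le _)]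
  have hker : LinearMap.ker Φ ≠ ⊥ := by
    apply LinearMap.ker_ne_bot_of_finrank_lt
    simp only [Module.finrank_fintype_fun_eq_card, Fintype.card_fin]
    simpa [ι] using hdim
  obtain ⟨β, hβ, hβ0⟩ := (Submodule.ne_bot_iff _).1 hker
  have hW : ∑ t, C (β t) * w t = 0 := by
    ext k
    rw [finsetSum_coeff, coeff_zero]
    by_cases hk : k < L
    · have := congrFun (LinearMap.mem_ker.1 hβ) ⟨k, hk⟩
      simpa [Φ] using this
    · refine Finset.sum_eq_zero fun t _ => ?_
      rw [coeff_C_mul, coeff_eq_zero_of_natDegree_lt (lt_of_lt_of_le (hw t) (not_lt.1 hk)), mul_zero]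
  -- the auxiliary polynomial
  let A : Fin J → Fin d → E[X] := fun j l => ∑ i : Fin a, C ((β (l, j, i)) ^ s) * X ^ (i : ℕ)
  let H : Fin J → E[X] := fun j => ∑ l : Fin d, A j l * (f ^ e) ^ (l : ℕ)
  let T : E[X] := ∑ j : Fin J, X ^ ((j : ℕ) * s) * H j
  have hs0 : 0 < s := by omega
  have hAdeg : ∀ j l, (A j l).natDegree ≤ a := by
    intro j l
    refine natDegree_sum_le_of_forall_le _ _ fun i _ => ?_
    exact (natDegree_C_mul_X_pow_le _ _).trans i.2.le
  have hkey : ∀ j, X ^ s ∣ H j → A j = 0 := by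
    intro j hj
    refine wb_key p n s d e a D hsp hs (by omega) f hf0 hg hD (A j) (hAdeg j) ?_ hj
    rw [ha]; omega
  have hT0 : T ≠ 0 := by
    intro hT
    have h1 := wb_shift s J H (fun j hj => by simp [H, hkey j hj]) hT
    apply hβ0
    funext t
    obtain ⟨l, j, i⟩ := t
    have h2 := congrFun (hkey j (by rw [h1 j]; exact dvd_zero _)) l
    have h3 := congrArg (fun Q => coeff Q (i : ℕ)) h2
    simp only [A, finsetSum_coeff, coeff_C_mul, coeff_X_pow, Pi.zero_apply, coeff_zero] at h3
    rw [Finset.sum_eq_single i] at h3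
    · simp only [if_true, mul_one] at h3
      exact eq_zero_of_pow_eq_zero h3
    · intro m _ hm
      rw [if_neg, mul_zero]
      intro h; exact hm (Fin.ext h.symm)
    · simp
  have hTdeg : T.natDegree ≤ s * (e + 3 * D + 3) := by
    refine natDegree_sum_le_of_forall_le _ _ fun j _ => ?_
    refine natDegree_mul_le.trans ?_
    have hHdeg : (H j).natDegree ≤ a + D * s := by
      refine natDegree_sum_le_of_forall_le _ _ fun l _ => ?_
      refine natDegree_mul_le.trans (add_le_add (hAdeg _ _) ?_)
      rw [← pow_mul]
      exact hfdeg _ (by omega)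
    rw [natDegree_X_pow]
    have hj : (j : ℕ) * s ≤ J * s := Nat.mul_le_mul_right _ j.2.le
    have has : a ≤ s := by nlinarith
    calc (j : ℕ) * s + (H j).natDegree ≤ J * s + (s + D * s) := by omega
      _ = s * (e + 3 * D + 3) := by rw [hJ]; ring
  refine le_trans ?_ hTdeg
  refine le_trans ?_ (card_roots' T)
  refine le_trans ?_ (Multiset.toFinset_card_le _)
  apply Finset.card_le_card
  intro x hx
  rw [Finset.mem_filter] at hx
  have hx := hx.2
  rw [Multiset.mem_toFinset, mem_roots hT0, IsRoot]
  set y := f.eval x with hy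
  have hy0 : y ≠ 0 := by
    intro h
    rw [h, zero_pow] at hx
    · exact hζ hx.symm
    · apply Nat.mul_ne_zero <;> omega
  have hfrob : ∀ z : E, (z ^ s) ^ s = z := by
    intro z
    rw [← pow_mul, ← sq, ← hcard, FiniteField.pow_card]
  have hTx : T.eval x = ∑ t : ι, (β t) ^ s * x ^ ((t.2.2 : ℕ) + t.2.1 * s) * y ^ (e * t.1) := by
    simp only [T, H, A, eval_finsetSum, eval_mul, eval_pow, eval_X, eval_C, ← hy, ι,
      Fintype.sum_prod_type]
    rw [Finset.sum_comm]
    refine Finset.sum_congr rfl fun j _ => ?_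
    rw [Finset.mul_sum]
    refine Finset.sum_congr rfl fun l _ => ?_
    rw [Finset.sum_mul, Finset.mul_sum]
    refine Finset.sum_congr rfl fun i _ => ?_
    rw [pow_add, pow_mul y]
    ring
  have hWx := congrArg (eval x) hW
  simp only [w, eval_finsetSum, eval_mul, eval_pow, eval_X, eval_C, ← hy, eval_zero] at hWx
  have hfin : y ^ (e * (d - 1)) * (T.eval x) ^ s = 0 := by
    rw [← hWx, hTx, hsp, sum_pow_char_pow, Finset.mul_sum, ← hsp]
    refine Finset.sum_congr rfl fun t _ => ?_
    rw [mul_pow, mul_pow, hfrob]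
    have hx1 : (x ^ ((t.2.2 : ℕ) + t.2.1 * s)) ^ s = x ^ ((t.2.2 : ℕ) * s + t.2.1) := by
      rw [pow_add, mul_pow, pow_mul x _ s, hfrob, ← pow_mul, ← pow_add]
    have hy1 : y ^ (e * (d - 1)) * (y ^ (e * (t.1 : ℕ))) ^ s = ζ ^ (t.1 : ℕ) * y ^ (e * (d - 1 - t.1)) := by
      rw [← hx, ← pow_mul, ← pow_mul, ← pow_add, ← pow_add]
      congr 1
      obtain ⟨r, hr⟩ : ∃ r, d - 1 = t.1 + r := ⟨d - 1 - t.1, by omega⟩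
      rw [hr, Nat.add_sub_cancel_left]
      ring
    rw [hx1]
    linear_combination (β t * x ^ ((t.2.2 : ℕ) * s + t.2.1)) * hy1
  exact eq_zero_of_pow_eq_zero ((mul_eq_zero.1 hfin).resolve_left (pow_ne_zero _ hy0))

end

section
open Polynomial IntermediateField

theorem wb_norm_pb {K L : Type*} [Field K] [Field L] [Algebra K L] (pb : PowerBasis K L) (v : K) :
    Algebra.norm K (algebraMap K L v - pb.gen) = (minpoly K pb.gen).eval v := by
  rw [← charpoly_leftMulMatrix, Matrix.eval_charpoly, Algebra.norm_eq_matrix_det pb.basis, map_sub]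
  rw [AlgHom.commutes, Matrix.scalar_apply, Matrix.algebraMap_eq_diagonal]
  rfl

theorem wb_norm {K L : Type*} [Field K] [Field L] [Algebra K L] [FiniteDimensional K L] (x : L)
    (v : K) :
    Algebra.norm K (algebraMap K L v - x) =
      ((minpoly K x).eval v) ^ (Module.finrank K L / (minpoly K x).natDegree) := by
  have hx : IsIntegral K x := Algebra.IsIntegral.isIntegral x
  have h1 := wb_norm_pb (adjoin.powerBasis hx) v
  rw [adjoin.powerBasis_gen, minpoly_gen] at h1
  have h2 : algebraMap K L v - x = algebraMap K⟮x⟯ L (algebraMap K K⟮x⟯ v - AdjoinSimple.gen K x) := by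
    rw [map_sub, AdjoinSimple.algebraMap_gen, ← IsScalarTower.algebraMap_apply]
  rw [h2, ← Algebra.norm_norm (S := K⟮x⟯), Algebra.norm_algebraMap, map_pow, h1]
  congr 1
  rw [← adjoin.finrank hx, ← Module.finrank_mul_finrank K K⟮x⟯ L, Nat.mul_div_cancel_left]
  exact Module.finrank_pos

variable {F : Type*} [Field F] [Fintype F]

theorem wb_mon_finite (F : Type*) [Field F] [Fintype F] (n : ℕ) :
    {g : F[X] | g.Monic ∧ g.natDegree = n}.Finite := by
  have : Finite (Fin n → F) := inferInstance
  exact Finite.of_equiv _ ((monicEquivDegreeLT n).trans (degreeLTEquiv F n).toEquiv).symm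

/-- Monic polynomials of degree `n` over a finite field. -/
noncomputable def wbMon (F : Type*) [Field F] [Fintype F] (n : ℕ) : Finset F[X] :=
  (wb_mon_finite F n).toFinset

theorem mem_wbMon {n : ℕ} {g : F[X]} : g ∈ wbMon F n ↔ g.Monic ∧ g.natDegree = n := by
  simp [wbMon]

open Classical in
/-- Monic irreducible polynomials of degree at most `n`. -/
noncomputable def wbIrr (F : Type*) [Field F] [Fintype F] (n : ℕ) : Finset F[X] :=
  (Finset.Icc 1 n).biUnion (fun m => (wbMon F m).filter Irreducible)

theorem mem_wbIrr {n : ℕ} {P : F[X]} :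
    P ∈ wbIrr F n ↔ P.Monic ∧ Irreducible P ∧ P.natDegree ≤ n := by
  simp only [wbIrr, Finset.mem_biUnion, Finset.mem_filter, mem_wbMon, Finset.mem_Icc]
  constructor
  · rintro ⟨m, ⟨h1, h2⟩, ⟨h3, h4⟩, h5⟩
    exact ⟨h3, h5, by omega⟩
  · rintro ⟨h1, h2, h3⟩
    exact ⟨P.natDegree, ⟨h2.natDegree_pos, h3⟩, ⟨h1, rfl⟩, h2⟩

theorem wb_card_roots {E : Type*} [Field E] [Fintype E] [DecidableEq E] [DecidableEq F[X]] [Algebra F E] (P : F[X])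
    (hm : P.Monic) (hP : Irreducible P) (hd : P.natDegree ∣ Module.finrank F E) :
    (Finset.univ.filter (fun x : E => minpoly F x = P)).card = P.natDegree := by
  have h1 : P ∣ X ^ (Nat.card F) ^ (Module.finrank F E) - X :=
    (hP.natDegree_dvd_iff_dvd_X_pow_card_pow_sub_X).1 hd
  rw [← Module.natCard_eq_pow_finrank, Nat.card_eq_fintype_card] at h1
  have h2 : P.map (algebraMap F E) ∣ X ^ Fintype.card E - X := by
    have := Polynomial.map_dvd (algebraMap F E) h1
    simpa using this
  have hne : (X ^ Fintype.card E - X : E[X]) ≠ 0 :=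
    FiniteField.X_pow_card_sub_X_ne_zero E Fintype.one_lt_card
  have hroots := FiniteField.roots_X_pow_card_sub_X E
  have hspl : (X ^ Fintype.card E - X : E[X]).Splits := by
    rw [splits_iff_card_roots, hroots, FiniteField.X_pow_card_sub_X_natDegree_eq E Fintype.one_lt_card]
    rfl
  have hspP : (P.map (algebraMap F E)).Splits := hspl.of_dvd hne h2
  have hnod : (P.map (algebraMap F E)).roots.Nodup := by
    refine Multiset.nodup_of_le (roots.le_of_dvd hne h2) ?_
    rw [hroots]; exact Finset.univ.nodup
  rw [← natDegree_map (algebraMap F E), hspP.natDegree_eq_card_roots,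
    ← Multiset.toFinset_card_of_nodup hnod]
  congr 1
  ext x
  rw [Finset.mem_filter, Multiset.mem_toFinset, mem_roots (hm.map _).ne_zero]
  simp only [Finset.mem_univ, true_and, IsRoot, eval_map_algebraMap]
  constructor
  · rintro rfl; exact minpoly.aeval F x
  · intro h; exact (minpoly.eq_of_irreducible_of_monic hP h hm).symm

theorem wb_S {E : Type*} [Field E] [Fintype E] [Algebra F E] (lam : F[X] →* ℂ) (n : ℕ)
    (hn : Module.finrank F E ≤ n) :
    ∑ x : E, lam (minpoly F x) ^ (Module.finrank F E / (minpoly F x).natDegree) =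
    ∑ P ∈ wbIrr F n, if P.natDegree ∣ Module.finrank F E then
      (P.natDegree : ℂ) * lam P ^ (Module.finrank F E / P.natDegree) else 0 := by
  classical
  have hfd : FiniteDimensional F E := Module.Finite.of_finite
  have hIntg : ∀ x : E, IsIntegral F x := fun x => Algebra.IsIntegral.isIntegral x
  have hdv : ∀ x : E, (minpoly F x).natDegree ∣ Module.finrank F E := fun x =>
    minpoly.degree_dvd (hIntg x)
  rw [← Finset.sum_fiberwise_of_maps_to (t := wbIrr F n) (g := fun x : E => minpoly F x)]
  · refine Finset.sum_congr rfl fun P hP => ?_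
    rw [mem_wbIrr] at hP
    split_ifs with h
    · have hc := wb_card_roots (E := E) P hP.1 hP.2.1 h
      have hcon : ∀ x ∈ Finset.univ.filter (fun x : E => minpoly F x = P),
          lam (minpoly F x) ^ (Module.finrank F E / (minpoly F x).natDegree) =
          lam P ^ (Module.finrank F E / P.natDegree) := by
        intro x hx
        rw [(Finset.mem_filter.1 hx).2]
      rw [Finset.sum_congr rfl hcon, Finset.sum_const, hc, nsmul_eq_mul]
    · refine Finset.sum_eq_zero fun x hx => ?_
      exact absurd ((Finset.mem_filter.1 hx).2 ▸ hdv x) h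
  · intro x _
    rw [mem_wbIrr]
    exact ⟨minpoly.monic (hIntg x), minpoly.irreducible (hIntg x),
      (Nat.le_of_dvd Module.finrank_pos (hdv x)).trans hn⟩

open Classical in
theorem wb_deg_sum (n : ℕ) (g : F[X]) (hg : g.Monic) (hn : g.natDegree = n) :
    (n : ℂ) = ∑ P ∈ wbIrr F n, ∑ j ∈ Finset.Icc 1 n, if P ^ j ∣ g then (P.natDegree : ℂ) else 0 := by
  classical
  let t := UniqueFactorizationMonoid.normalizedFactors g
  have hg0 := hg.ne_zero
  have hprod : t.prod = g := by
    rw [UniqueFactorizationMonoid.prod_normalizedFactors_eq hg0, hg.normalize_eq_self]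
  have hirr : ∀ P ∈ t, Irreducible P ∧ P.Monic := by
    intro P hP
    have h1 := UniqueFactorizationMonoid.irreducible_of_normalized_factor P hP
    have h2 := UniqueFactorizationMonoid.normalize_normalized_factor P hP
    exact ⟨h1, by rw [← h2]; exact monic_normalize h1.ne_zero⟩
  have hdeg : n = (t.map natDegree).sum := by
    rw [← hn, ← hprod, natDegree_multiset_prod]
    · intro h; exact (hirr 0 h).1.ne_zero rfl
  have hdvd : ∀ P ∈ wbIrr F n, ∀ j : ℕ, P ^ j ∣ g ↔ j ≤ t.count P := by
    intro P hP j
    rw [mem_wbIrr] at hP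
    rw [pow_dvd_iff_le_emultiplicity,
      UniqueFactorizationMonoid.emultiplicity_eq_count_normalizedFactors hP.2.1 hg0,
      hP.1.normalize_eq_self]
    simp [t]
  have hle : ∀ P ∈ wbIrr F n, t.count P ≤ n := by
    intro P hP
    have h1 : P ^ (t.count P) ∣ g := (hdvd P hP _).2 le_rfl
    have h2 := natDegree_le_of_dvd h1 hg0
    rw [mem_wbIrr] at hP
    rw [natDegree_pow, hn] at h2
    nlinarith [hP.2.1.natDegree_pos]
  have hin : ∀ P ∈ wbIrr F n, (∑ j ∈ Finset.Icc 1 n, if P ^ j ∣ g then (P.natDegree : ℂ) else 0) =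
      ((t.count P * P.natDegree : ℕ) : ℂ) := by
    intro P hP
    rw [← Finset.sum_filter, Finset.sum_const, nsmul_eq_mul]
    push_cast
    congr 2
    have : (Finset.Icc 1 n).filter (fun j => P ^ j ∣ g) = Finset.Icc 1 (t.count P) := by
      ext j
      rw [Finset.mem_filter, Finset.mem_Icc, Finset.mem_Icc, hdvd P hP]
      have := hle P hP
      omega
    rw [this]; simp
  rw [Finset.sum_congr rfl hin, ← Nat.cast_sum]
  congr 1
  refine hdeg.trans ?_
  rw [Finset.sum_multiset_map_count]
  refine Finset.sum_subset ?_ ?_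
  · intro P hP
    rw [Multiset.mem_toFinset] at hP
    rw [mem_wbIrr]
    refine ⟨(hirr P hP).2, (hirr P hP).1, ?_⟩
    rw [← hn]
    exact natDegree_le_of_dvd (UniqueFactorizationMonoid.dvd_of_mem_normalizedFactors hP) hg0
  · intro P _ hP
    rw [Multiset.mem_toFinset] at hP
    rw [Multiset.count_eq_zero_of_notMem hP]; simp

/-- Coefficients of the L-function. -/
noncomputable def wbc (lam : F[X] →* ℂ) (n : ℕ) : ℂ := ∑ g ∈ wbMon F n, lam g

theorem wb_conv (lam : F[X] →* ℂ) (n : ℕ) :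
    (n : ℂ) * wbc lam n = ∑ r ∈ Finset.Icc 1 n,
      (∑ P ∈ wbIrr F n, if P.natDegree ∣ r then (P.natDegree : ℂ) * lam P ^ (r / P.natDegree) else 0)
        * wbc lam (n - r) := by
  classical
  have h1 : (n : ℂ) * wbc lam n = ∑ P ∈ wbIrr F n, ∑ j ∈ Finset.Icc 1 n,
      ∑ g ∈ wbMon F n, if P ^ j ∣ g then (P.natDegree : ℂ) * lam g else 0 := by
    have h0 : (n : ℂ) * wbc lam n = ∑ g ∈ wbMon F n, ∑ P ∈ wbIrr F n, ∑ j ∈ Finset.Icc 1 n,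
        if P ^ j ∣ g then (P.natDegree : ℂ) * lam g else 0 := by
      rw [wbc, Finset.mul_sum]
      refine Finset.sum_congr rfl fun g hg => ?_
      rw [mem_wbMon] at hg
      rw [wb_deg_sum n g hg.1 hg.2, Finset.sum_mul]
      refine Finset.sum_congr rfl fun P _ => ?_
      rw [Finset.sum_mul]
      refine Finset.sum_congr rfl fun j _ => ?_
      split_ifs <;> simp
    rw [h0, Finset.sum_comm]
    refine Finset.sum_congr rfl fun P _ => ?_
    rw [Finset.sum_comm]
  rw [h1]
  simp_rw [Finset.sum_mul]
  rw [Finset.sum_comm (s := Finset.Icc 1 n)]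
  refine Finset.sum_congr rfl fun P hP => ?_
  rw [mem_wbIrr] at hP
  have hpos := hP.2.1.natDegree_pos
  set m := P.natDegree with hm
  have hinner : ∀ j ∈ Finset.Icc 1 n, (∑ g ∈ wbMon F n, if P ^ j ∣ g then (m : ℂ) * lam g else 0) =
      if j * m ≤ n then (m : ℂ) * lam P ^ j * wbc lam (n - j * m) else 0 := by
    intro j _
    split_ifs with hj
    · rw [← Finset.sum_filter, wbc, Finset.mul_sum]
      symm
      refine Finset.sum_bij (fun h _ => P ^ j * h) ?_ ?_ ?_ ?_
      · intro h hh
        rw [mem_wbMon] at hh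
        rw [Finset.mem_filter, mem_wbMon]
        refine ⟨⟨(hP.1.pow j).mul hh.1, ?_⟩, Dvd.intro _ rfl⟩
        rw [(hP.1.pow j).natDegree_mul hh.1, natDegree_pow, hh.2, ← hm]
        omega
      · intro a _ b _ hab
        exact mul_left_cancel₀ (hP.1.pow j).ne_zero hab
      · intro g hg
        rw [Finset.mem_filter, mem_wbMon] at hg
        obtain ⟨⟨hg1, hg2⟩, h, rfl⟩ := hg
        have hhm : h.Monic := (hP.1.pow j).of_mul_monic_left hg1
        refine ⟨h, ?_, rfl⟩
        rw [mem_wbMon]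
        refine ⟨hhm, ?_⟩
        rw [(hP.1.pow j).natDegree_mul hhm, natDegree_pow, ← hm] at hg2
        omega
      · intro h _
        rw [map_mul, map_pow]; ring
    · refine Finset.sum_eq_zero fun g hg => ?_
      rw [mem_wbMon] at hg
      rw [if_neg]
      intro hd
      have := natDegree_le_of_dvd hd hg.1.ne_zero
      rw [natDegree_pow, hg.2, ← hm] at this
      exact hj this
  rw [Finset.sum_congr rfl hinner, ← Finset.sum_filter]
  simp_rw [ite_mul, zero_mul]
  rw [← Finset.sum_filter]
  refine Finset.sum_bij (fun j _ => j * m) ?_ ?_ ?_ ?_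
  · intro j hj
    rw [Finset.mem_filter, Finset.mem_Icc] at hj ⊢
    refine ⟨⟨?_, hj.2⟩, Dvd.intro_left _ rfl⟩
    exact Nat.mul_pos hj.1.1 hpos
  · intro a _ b _ hab
    exact Nat.eq_of_mul_eq_mul_right hpos hab
  · intro r hr
    rw [Finset.mem_filter, Finset.mem_Icc] at hr
    obtain ⟨⟨hr1, hr2⟩, j, rfl⟩ := hr
    refine ⟨j, ?_, mul_comm _ _⟩
    rw [Finset.mem_filter, Finset.mem_Icc, mul_comm j m]
    refine ⟨⟨?_, ?_⟩, hr2⟩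
    · exact Nat.pos_of_mul_pos_left hr1
    · nlinarith
  · intro j _
    rw [Nat.mul_div_cancel _ hpos]

end

section
open Polynomial

theorem wb_newton_prod (t : Multiset ℂ) :
    PowerSeries.X * PowerSeries.derivative ℂ ((t.map (fun α => 1 - PowerSeries.C α * PowerSeries.X)).prod) =
    - ((t.map (fun α => 1 - PowerSeries.C α * PowerSeries.X)).prod *
      PowerSeries.mk (fun r => if r = 0 then 0 else (t.map (fun α => α ^ r)).sum)) := by
  induction t using Multiset.induction_on with
  | empty =>
    have : (PowerSeries.mk (fun _ : ℕ => (0 : ℂ))) = 0 := by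
      ext r; simp
    simp [this]
  | cons α t ih =>
    have h1 : PowerSeries.X * PowerSeries.derivative ℂ (1 - PowerSeries.C α * PowerSeries.X) =
        - ((1 - PowerSeries.C α * PowerSeries.X) *
          PowerSeries.mk (fun r => if r = 0 then 0 else α ^ r)) := by
      ext r
      have hd : PowerSeries.derivative ℂ (1 - PowerSeries.C α * PowerSeries.X) = - PowerSeries.C α := by
        ext k
        rw [PowerSeries.coeff_derivative]
        rcases k with _ | k
        · simp [PowerSeries.coeff_one, PowerSeries.coeff_X]
        · simp [PowerSeries.coeff_one, PowerSeries.coeff_X, PowerSeries.coeff_C]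
      rw [hd, sub_mul, one_mul, mul_assoc, map_neg, map_sub, PowerSeries.coeff_C_mul]
      rcases r with _ | r
      · simp
      · rw [PowerSeries.coeff_succ_X_mul, PowerSeries.coeff_succ_X_mul]
        rcases r with _ | r
        · simp
        · simp [PowerSeries.coeff_C]; ring
    have h2 : PowerSeries.mk (fun r => if r = 0 then (0 : ℂ) else ((α ::ₘ t).map (fun α => α ^ r)).sum) =
        PowerSeries.mk (fun r => if r = 0 then 0 else α ^ r) +
        PowerSeries.mk (fun r => if r = 0 then 0 else (t.map (fun α => α ^ r)).sum) := by
      ext r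
      by_cases hr : r = 0 <;> simp [hr]
    rw [h2, Multiset.map_cons, Multiset.prod_cons, Derivation.leibniz]
    simp only [smul_eq_mul]
    linear_combination (1 - PowerSeries.C α * PowerSeries.X) * ih +
      ((t.map (fun α => 1 - PowerSeries.C α * PowerSeries.X)).prod) * h1

theorem wb_newton (c S : ℕ → ℂ) (k : ℕ) (hk : 0 < k) (hc0 : c 0 = 1) (hc : ∀ n, k ≤ n → c n = 0)
    (h : ∀ n : ℕ, (n : ℂ) * c n = ∑ r ∈ Finset.Icc 1 n, S r * c (n - r)) :
    ∃ t : Multiset ℂ, t.card ≤ k - 1 ∧ ∀ r, 1 ≤ r → S r = - (t.map (fun α => α ^ r)).sum := by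
  let L : ℂ[X] := ∑ i ∈ Finset.range k, C (c i) * X ^ i
  have hLc : ∀ n, L.coeff n = c n := by
    intro n
    simp only [L, finsetSum_coeff, coeff_C_mul, coeff_X_pow]
    by_cases hn : n < k
    · rw [Finset.sum_eq_single n]
      · simp
      · intro b _ hb; simp [hb.symm]
      · simp [hn]
    · rw [hc n (by omega)]
      refine Finset.sum_eq_zero fun b hb => ?_
      rw [Finset.mem_range] at hb
      rw [if_neg (by omega), mul_zero]
  have hL0 : L.eval 0 = 1 := by rw [← coeff_zero_eq_eval_zero, hLc, hc0]
  have hLne : L ≠ 0 := by intro h; rw [h] at hL0; simp at hL0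
  have hLd : L.natDegree ≤ k - 1 := by
    rw [natDegree_le_iff_coeff_eq_zero]
    intro n hn
    rw [hLc, hc n (by omega)]
  let t := L.roots.map (fun ρ => ρ⁻¹)
  have hroot : ∀ ρ ∈ L.roots, ρ ≠ 0 := by
    rintro ρ hρ rfl
    have := (mem_roots'.1 hρ).2
    rw [IsRoot, hL0] at this
    exact one_ne_zero this
  have hprod : L = (t.map (fun α => 1 - C α * X)).prod := by
    have h1 := (IsAlgClosed.splits L).eq_prod_roots
    have h2 : (L.roots.map (fun a => X - C a)).prod =
        (L.roots.map (fun a => C (-a))).prod * (t.map (fun α => 1 - C α * X)).prod := by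
      rw [Multiset.map_map, ← Multiset.prod_map_mul]
      congr 1
      refine Multiset.map_congr rfl fun ρ hρ => ?_
      have : C ρ * C ρ⁻¹ = (1 : ℂ[X]) := by rw [← C_mul, mul_inv_cancel₀ (hroot ρ hρ), C_1]
      simp only [Function.comp_apply, C_neg]
      linear_combination -X * this
    have h3 : (L.roots.map (fun a => C (-a))).prod = C ((L.roots.map (fun a => -a)).prod) := by
      rw [map_multiset_prod, Multiset.map_map]; rfl
    rw [h2, h3, ← mul_assoc, ← C_mul] at h1
    have h4 := congrArg (eval 0) h1
    rw [hL0, eval_mul, eval_C, eval_multiset_prod, Multiset.map_map] at h4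
    have h5 : (t.map (eval 0 ∘ fun α => 1 - C α * X)).prod = 1 := by
      apply Multiset.prod_eq_one
      intro x hx
      obtain ⟨α, _, rfl⟩ := Multiset.mem_map.1 hx
      simp
    rw [h5, mul_one] at h4
    rw [← h4, C_1, one_mul] at h1
    exact h1
  refine ⟨t, ?_, ?_⟩
  · rw [Multiset.card_map]; exact (card_roots' L).trans hLd
  have hps : (L : PowerSeries ℂ) = (t.map (fun α => 1 - PowerSeries.C α * PowerSeries.X)).prod := by
    conv_lhs => rw [hprod]
    rw [← coeToPowerSeries.ringHom_apply, map_multiset_prod, Multiset.map_map]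
    congr 1
    refine Multiset.map_congr rfl fun α _ => ?_
    simp
  have hN := wb_newton_prod t
  rw [← hps] at hN
  have hS : PowerSeries.X * PowerSeries.derivative ℂ (L : PowerSeries ℂ) =
      (L : PowerSeries ℂ) * PowerSeries.mk (fun r => if r = 0 then 0 else S r) := by
    ext n
    have h1 : PowerSeries.coeff n (PowerSeries.X * PowerSeries.derivative ℂ (L : PowerSeries ℂ)) = (n : ℂ) * c n := by
      rcases n with _ | n
      · simp
      · rw [PowerSeries.coeff_succ_X_mul, PowerSeries.coeff_derivative,
          Polynomial.coeff_coe, hLc]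
        push_cast; ring
    rw [h1]
    rw [mul_comm (L : PowerSeries ℂ), PowerSeries.coeff_mul, Finset.Nat.sum_antidiagonal_eq_sum_range_succ_mk]
    simp only [PowerSeries.coeff_mk, Polynomial.coeff_coe, hLc]
    rw [h n, Finset.sum_range_succ', Finset.range_eq_Ico, Finset.sum_Ico_add' (fun r => (if r = 0 then 0 else S r) * c (n - r)) 0 n 1]
    simp only [if_true, zero_mul, add_zero]
    refine Finset.sum_congr ?_ fun r hr => ?_
    · ext r; simp
    · have : r ≠ 0 := by rw [Finset.mem_Ico] at hr; omega
      rw [if_neg this]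
  have hLps : (L : PowerSeries ℂ) ≠ 0 := by
    rw [Ne, Polynomial.coe_eq_zero_iff]; exact hLne
  rw [hS, ← mul_neg] at hN
  have hEq := mul_left_cancel₀ hLps hN
  intro r hr
  have := congrArg (PowerSeries.coeff r) hEq
  have hr0 : r ≠ 0 := by omega
  simpa [hr0] using this

theorem wb_growth (t : Multiset ℂ) (R C : ℝ) (hR : 0 < R) (m0 : ℕ)
    (h : ∀ m, m0 ≤ m → ‖(t.map (fun α => α ^ m)).sum‖ ≤ C * R ^ m) : ∀ α ∈ t, ‖α‖ ≤ R := by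
  classical
  intro β hβ
  let Q : ℂ[X] := ∏ γ ∈ t.toFinset.erase β, (X - Polynomial.C γ)
  have hQβ : Q.eval β ≠ 0 := by
    simp only [Q, eval_prod, eval_sub, eval_X, eval_C]
    rw [Finset.prod_ne_zero_iff]
    intro γ hγ
    exact sub_ne_zero.2 (Finset.ne_of_mem_erase hγ).symm
  have hQ0 : ∀ γ ∈ t.toFinset, γ ≠ β → Q.eval γ = 0 := by
    intro γ hγ hne
    simp only [Q, eval_prod, eval_sub, eval_X, eval_C]
    exact Finset.prod_eq_zero (Finset.mem_erase.2 ⟨hne, hγ⟩) (sub_self _)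
  have hsum1 : ∀ m, (t.map (fun α => α ^ m * Q.eval α)).sum = (t.count β : ℂ) * (β ^ m * Q.eval β) := by
    intro m
    rw [Finset.sum_multiset_map_count, Finset.sum_eq_single β]
    · rw [nsmul_eq_mul]
    · intro γ hγ hne
      rw [hQ0 γ hγ hne]; simp
    · intro hn; exact absurd (Multiset.mem_toFinset.2 hβ) hn
  have hsum2 : ∀ m, (t.map (fun α => α ^ m * Q.eval α)).sum =
      ∑ i ∈ Finset.range (Q.natDegree + 1), Q.coeff i * (t.map (fun α => α ^ (m + i))).sum := by
    intro m
    have : ∀ α : ℂ, α ^ m * Q.eval α = ∑ i ∈ Finset.range (Q.natDegree + 1), Q.coeff i * α ^ (m + i) := by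
      intro α
      rw [eval_eq_sum_range, Finset.mul_sum]
      refine Finset.sum_congr rfl fun i _ => ?_
      rw [pow_add]; ring
    simp_rw [this, ← Multiset.sum_map_mul_left]
    rw [Multiset.sum_map_sum]
  set C' : ℝ := ∑ i ∈ Finset.range (Q.natDegree + 1), ‖Q.coeff i‖ * (C * R ^ i) with hC'
  have hb : ∀ m, m0 ≤ m → ‖β‖ ^ m * ‖Q.eval β‖ ≤ C' * R ^ m := by
    intro m hm
    have h1 : ‖(t.count β : ℂ) * (β ^ m * Q.eval β)‖ ≤ C' * R ^ m := by
      rw [← hsum1, hsum2, hC', Finset.sum_mul]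
      refine (norm_sum_le _ _).trans (Finset.sum_le_sum fun i _ => ?_)
      rw [norm_mul, mul_assoc]
      refine mul_le_mul_of_nonneg_left ?_ (norm_nonneg _)
      refine (h (m + i) (by omega)).trans (le_of_eq ?_)
      rw [pow_add]; ring
    refine le_trans ?_ h1
    rw [norm_mul, norm_mul, norm_pow, Complex.norm_natCast]
    have : (1 : ℝ) ≤ t.count β := by exact_mod_cast Multiset.one_le_count_iff_mem.2 hβ
    nlinarith [mul_nonneg (pow_nonneg (norm_nonneg β) m) (norm_nonneg (Q.eval β))]
  by_contra hlt
  push Not at hlt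
  have hq : 0 < ‖Q.eval β‖ := norm_pos_iff.2 hQβ
  have hgt : 1 < ‖β‖ / R := (one_lt_div hR).2 hlt
  obtain ⟨N, hN⟩ := pow_unbounded_of_one_lt (C' / ‖Q.eval β‖) hgt
  have h1 := hb (N + m0) (by omega)
  have h2 : (‖β‖ / R) ^ N ≤ (‖β‖ / R) ^ (N + m0) := pow_le_pow_right₀ hgt.le (by omega)
  have h3 : (‖β‖ / R) ^ (N + m0) ≤ C' / ‖Q.eval β‖ := by
    rw [div_pow, div_le_div_iff₀ (pow_pos hR _) hq]
    exact h1
  linarith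

end

section
open Polynomial

/-- The multiplicative function attached to a character and weighted points. -/
noncomputable def wbLam {F : Type*} [Field F] (χ : MulChar F ℂ) (I : Finset F) (e : F → ℕ) :
    F[X] →* ℂ where
  toFun g := ∏ i ∈ I, χ (g.eval i) ^ e i
  map_one' := by simp
  map_mul' g h := by
    simp only [eval_mul, map_mul, mul_pow, Finset.prod_mul_distrib]

theorem wbLam_apply {F : Type*} [Field F] (χ : MulChar F ℂ) (I : Finset F) (e : F → ℕ) (g : F[X]) :
    wbLam χ I e g = ∏ i ∈ I, χ (g.eval i) ^ e i := rfl

theorem wb_c_zero {F : Type*} [Field F] [Fintype F] (lam : F[X] →* ℂ) : wbc lam 0 = 1 := by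
  have : wbMon F 0 = {1} := by
    ext g
    rw [mem_wbMon, Finset.mem_singleton]
    constructor
    · rintro ⟨h1, h2⟩; exact h1.natDegree_eq_zero.1 h2
    · rintro rfl; exact ⟨monic_one, natDegree_one⟩
  rw [wbc, this, Finset.sum_singleton, map_one]

theorem wb_vanish {F : Type*} [Field F] [Fintype F] [DecidableEq F] (χ : MulChar F ℂ) (I : Finset F) (e : F → ℕ)
    (i0 : F) (hi0 : i0 ∈ I) (he : e i0 ≠ 0) (hχ : χ ^ e i0 ≠ 1) (n : ℕ) (hn : I.card ≤ n) :
    wbc (wbLam χ I e) n = 0 := by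
  set h : F[X] := ∏ j ∈ I.erase i0, (X - C j) with hh
  have hd : h.natDegree < n := by
    rw [hh, natDegree_prod_of_monic _ _ (fun j _ => monic_X_sub_C j)]
    simp only [natDegree_X_sub_C, Finset.sum_const, smul_eq_mul, mul_one]
    rw [Finset.card_erase_of_mem hi0]
    have : 0 < I.card := Finset.card_pos.2 ⟨i0, hi0⟩
    omega
  have hdt : ∀ t : F, (C t * h).natDegree < n := fun t =>
    (natDegree_C_mul_le t h).trans_lt hd
  have hmem : ∀ (t : F) (g : F[X]), g ∈ wbMon F n → g + C t * h ∈ wbMon F n := by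
    intro t g hg
    rw [mem_wbMon] at hg ⊢
    have hlt : (C t * h).natDegree < g.natDegree := by rw [hg.2]; exact hdt t
    refine ⟨hg.1.add_of_left (degree_lt_degree hlt), ?_⟩
    rw [natDegree_add_eq_left_of_natDegree_lt hlt, hg.2]
  have hshift : ∀ t : F, wbc (wbLam χ I e) n = ∑ g ∈ wbMon F n, wbLam χ I e (g + C t * h) := by
    intro t
    rw [wbc]
    symm
    refine Finset.sum_bij' (fun g _ => g + C t * h) (fun g _ => g + C (-t) * h)
      (fun g hg => hmem t g hg) (fun g hg => hmem (-t) g hg) ?_ ?_ ?_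
    · intro g _; rw [C_neg]; ring
    · intro g _; rw [C_neg]; ring
    · intro g _; rfl
  have hi0' : h.eval i0 ≠ 0 := by
    rw [hh, eval_prod, Finset.prod_ne_zero_iff]
    intro j hj
    simpa using sub_ne_zero.2 (Finset.ne_of_mem_erase hj).symm
  have hj0 : ∀ j ∈ I.erase i0, h.eval j = 0 := by
    intro j hj
    rw [hh, eval_prod]
    exact Finset.prod_eq_zero hj (by simp)
  have hsum : ∀ g : F[X], ∑ t : F, wbLam χ I e (g + C t * h) = 0 := by
    intro g
    have h1 : ∀ t : F, wbLam χ I e (g + C t * h) =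
        (χ ^ e i0) (g.eval i0 + t * h.eval i0) * ∏ i ∈ I.erase i0, χ (g.eval i) ^ e i := by
      intro t
      rw [wbLam_apply, ← Finset.mul_prod_erase _ _ hi0, MulChar.pow_apply' _ he]
      congr 1
      · simp
      · refine Finset.prod_congr rfl fun j hj => ?_
        simp [hj0 j hj]
    simp_rw [h1]
    rw [← Finset.sum_mul]
    have h2 : ∑ t : F, (χ ^ e i0) (g.eval i0 + t * h.eval i0) = ∑ u : F, (χ ^ e i0) u := by
      refine Fintype.sum_bijective (fun t => g.eval i0 + t * h.eval i0) ?_ _ _ (fun _ => rfl)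
      refine (Finite.injective_iff_bijective).1 ?_
      intro a b hab
      exact mul_right_cancel₀ hi0' (add_left_cancel hab)
    rw [h2, MulChar.sum_eq_zero_of_ne_one hχ, zero_mul]
  have hfin : (Fintype.card F : ℂ) * wbc (wbLam χ I e) n = 0 := by
    have : ∑ t : F, wbc (wbLam χ I e) n = (Fintype.card F : ℂ) * wbc (wbLam χ I e) n := by
      rw [Finset.sum_const, nsmul_eq_mul]; rfl
    rw [← this]
    rw [Finset.sum_congr rfl fun t _ => hshift t, Finset.sum_comm]
    exact Finset.sum_eq_zero fun g _ => hsum g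
  rcases mul_eq_zero.1 hfin with h | h
  · exact absurd h (by exact_mod_cast Fintype.card_ne_zero)
  · exact h

end

section
open Polynomial

theorem wb_structure {F : Type} [Field F] [Fintype F] [DecidableEq F] (χ : MulChar F ℂ) (I : Finset F)
    (e : F → ℕ) (i0 : F) (hi0 : i0 ∈ I) (he : e i0 ≠ 0) (hχ : χ ^ e i0 ≠ 1) :
    ∃ t : Multiset ℂ, t.card ≤ I.card - 1 ∧
      ∀ (E : Type) [Field E] [Fintype E] [Algebra F E],
        ∑ x : E, χ (Algebra.norm F (∏ i ∈ I, (algebraMap F E i - x) ^ e i)) =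
          - (t.map (fun α => α ^ Module.finrank F E)).sum := by
  let lam := wbLam χ I e
  let S : ℕ → ℂ := fun r => ∑ P ∈ wbIrr F r, if P.natDegree ∣ r then
    (P.natDegree : ℂ) * lam P ^ (r / P.natDegree) else 0
  have hS : ∀ n r, 1 ≤ r → r ≤ n → (∑ P ∈ wbIrr F n, if P.natDegree ∣ r then
    (P.natDegree : ℂ) * lam P ^ (r / P.natDegree) else 0) = S r := by
    intro n r h1 h2
    symm
    refine Finset.sum_subset ?_ ?_
    · intro P hP
      rw [mem_wbIrr] at hP ⊢
      exact ⟨hP.1, hP.2.1, hP.2.2.trans h2⟩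
    · intro P hP hP'
      rw [if_neg]
      intro hd
      apply hP'
      rw [mem_wbIrr] at hP ⊢
      exact ⟨hP.1, hP.2.1, Nat.le_of_dvd h1 hd⟩
  obtain ⟨t, ht, htS⟩ := wb_newton (wbc lam) S I.card (Finset.card_pos.2 ⟨i0, hi0⟩) (wb_c_zero lam)
    (fun n hn => wb_vanish χ I e i0 hi0 he hχ n hn) (by
      intro n
      rw [wb_conv]
      refine Finset.sum_congr rfl fun r hr => ?_
      rw [Finset.mem_Icc] at hr
      rw [hS n r hr.1 hr.2])
  refine ⟨t, ht, ?_⟩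
  intro E _ _ _
  have hfd : FiniteDimensional F E := Module.Finite.of_finite
  rw [← htS _ Module.finrank_pos, ← hS _ _ Module.finrank_pos le_rfl, ← wb_S lam _ le_rfl]
  refine Finset.sum_congr rfl fun x _ => ?_
  rw [map_prod, map_prod]
  simp only [lam, wbLam_apply]
  rw [← Finset.prod_pow]
  refine Finset.prod_congr rfl fun i _ => ?_
  rw [map_pow, map_pow, wb_norm, map_pow, pow_right_comm]

end

section
open Polynomial

theorem wb_dth {G : Type*} [CommGroup G] [IsCyclic G] [Fintype G] (d c : ℕ) (hc : 0 < c) (hG : Fintype.card G = d * c)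
    (u : G) (hu : u ^ c = 1) : ∃ w : G, u = w ^ d := by
  obtain ⟨g, hg⟩ := IsCyclic.exists_generator (α := G)
  obtain ⟨k, rfl⟩ := Subgroup.mem_zpowers_iff.1 (hg u)
  have ho : orderOf g = d * c := by rw [← hG]; exact (orderOf_eq_card_of_forall_mem_zpowers hg).trans Nat.card_eq_fintype_card
  rw [← zpow_natCast, ← zpow_mul, ← orderOf_dvd_iff_zpow_eq_one, ho] at hu
  push_cast at hu
  obtain ⟨j, rfl⟩ := Int.dvd_of_mul_dvd_mul_right (by exact_mod_cast hc.ne') hu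
  exact ⟨g ^ j, by rw [← zpow_natCast, ← zpow_mul, mul_comm]⟩

theorem wb_bound {F E : Type*} [Field F] [Fintype F] [Field E] [Fintype E] [Algebra F E]
    (p n : ℕ) [Fact p.Prime] [CharP E p] (s d e c D : ℕ)
    (hsp : s = p ^ n) (hs : d * e + 1 = s) (hd : 2 ≤ d) (hq : Fintype.card F = d * c + 1)
    (hcard : Fintype.card E = s ^ 2) (χ : MulChar F ℂ) (hχd : χ ^ d = 1) (hχ : χ ≠ 1)
    (f : E[X]) (hf0 : f.eval 0 ≠ 0)
    (hg : ∀ m : ℕ, (∀ x : E, d ∣ m * f.rootMultiplicity x) → d ∣ m)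
    (hD : f.natDegree ≤ D) (he : 6 * D + 4 < e) :
    ‖∑ x : E, χ (Algebra.norm F (f.eval x))‖ ≤ (s : ℝ) * (3 * D * d + 3 * d + D) := by
  classical
  have hfne : f ≠ 0 := by rintro rfl; simp at hf0
  have hc : 0 < c := by
    rcases Nat.eq_zero_or_pos c with h | h
    · have := Fintype.one_lt_card (α := F); rw [hq, h] at this; omega
    · exact h
  have hcardU : Fintype.card Fˣ = d * c := by rw [Fintype.card_units, hq]; rfl
  have hdc : 0 < d * c := Nat.mul_pos (by omega) hc
  -- exponent
  have hexp : ((Nat.card E - 1) / (Nat.card F - 1)) * c = e * (s + 1) := by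
    rw [Nat.card_eq_fintype_card, Nat.card_eq_fintype_card, hq, hcard]
    have h1 : d * c ∣ s ^ 2 - 1 := by
      have : Fintype.card E = Fintype.card F ^ Module.finrank F E := Module.card_eq_pow_finrank
      rw [← hcard, this]
      have h := Nat.sub_dvd_pow_sub_pow (Fintype.card F) 1 (Module.finrank F E)
      rw [one_pow] at h
      rwa [hq, Nat.add_sub_cancel, ← hq] at h
    have h2 : s ^ 2 - 1 = d * (e * (s + 1)) := by
      have : s ^ 2 = d * (e * (s + 1)) + 1 := by
        rw [← hs]; ring
      omega
    rw [Nat.add_sub_cancel]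
    obtain ⟨k, hk⟩ := h1
    rw [hk, Nat.mul_div_cancel_left _ hdc]
    rw [h2] at hk
    have : d * (e * (s + 1)) = d * (k * c) := by rw [hk]; ring
    exact (Nat.eq_of_mul_eq_mul_left (by omega) this).symm
  have hnorm : ∀ y : E, algebraMap F E ((Algebra.norm F y) ^ c) = y ^ (e * (s + 1)) := by
    intro y
    rw [map_pow, FiniteField.algebraMap_norm_eq_pow, ← pow_mul, hexp]
  -- counts
  let G : Fˣ → ℕ := fun u => (Finset.univ.filter (fun x : E => (f.eval x) ^ (e * (s + 1)) = algebraMap F E ((u : F) ^ c))).card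
  have hG : ∀ u, G u ≤ s * (e + 3 * D + 3) := by
    intro u
    refine wb_stepanov p n s d e D hsp hs hd hcard f hf0 hg hD he _ ?_
    rw [map_pow]
    exact pow_ne_zero _ (by simp)
  -- the fibre over x
  have hfib : ∀ y : F, y ≠ 0 → (Finset.univ.filter (fun u : Fˣ => y ^ c = (u : F) ^ c)).card = c ∧
      ∀ u : Fˣ, y ^ c = (u : F) ^ c → χ u = χ y := by
    intro y hy
    have hh : ∀ u : Fˣ, y ^ c = (u : F) ^ c ↔ ((Units.mk0 y hy)⁻¹ * u) ^ c = 1 := by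
      intro u
      rw [mul_pow, inv_pow, inv_mul_eq_one, ← Units.val_inj]
      simp
    constructor
    · have h1 : (Finset.univ.filter (fun u : Fˣ => y ^ c = (u : F) ^ c)).card =
          (Finset.univ.filter (fun u : Fˣ => u ^ c = 1)).card := by
        refine Finset.card_bij (fun u _ => (Units.mk0 y hy)⁻¹ * u) ?_ ?_ ?_
        · intro u hu
          simp only [Finset.mem_filter, Finset.mem_univ, true_and] at hu ⊢
          exact (hh u).1 hu
        · intro a _ b _ hab
          exact mul_left_cancel hab
        · intro b hb
          refine ⟨Units.mk0 y hy * b, ?_, by simp⟩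
          simp only [Finset.mem_filter, Finset.mem_univ, true_and] at hb ⊢
          rw [hh]; simpa using hb
      rw [h1]
      have h2 := IsCyclic.card_powMonoidHom_ker Fˣ c
      rw [Nat.card_eq_fintype_card (α := Fˣ), hcardU, Nat.gcd_eq_right (Dvd.intro_left d rfl)] at h2
      refine Eq.trans ?_ h2
      rw [Nat.card_eq_fintype_card, Fintype.card_subtype]
      congr 1
      ext u
      simp [MonoidHom.mem_ker]
    · intro u hu
      obtain ⟨w, hw⟩ := wb_dth d c hc hcardU _ ((hh u).1 hu)
      have h3 : (u : F) = y * (w : F) ^ d := by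
        have := congrArg (fun z : Fˣ => ((Units.mk0 y hy * z : Fˣ) : F)) hw
        simpa using this
      rw [h3, map_mul, map_pow]
      have h4 : χ (w : F) ^ d = 1 := by
        rw [← MulChar.pow_apply_coe, hχd]; simp
      rw [h4, mul_one]
  have hiff : ∀ (x : E) (u : Fˣ), (f.eval x) ^ (e * (s + 1)) = algebraMap F E ((u : F) ^ c) ↔
      (Algebra.norm F (f.eval x)) ^ c = (u : F) ^ c := by
    intro x u
    rw [← hnorm]
    exact (algebraMap F E).injective.eq_iff
  have hzero : ∀ (x : E) (u : Fˣ), f.eval x = 0 → ¬ (Algebra.norm F (f.eval x)) ^ c = (u : F) ^ c := by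
    intro x u hx h
    rw [hx, Algebra.norm_zero, zero_pow hc.ne'] at h
    exact pow_ne_zero c u.ne_zero h.symm
  have hfin : ∀ (x : E), f.eval x ≠ 0 → Algebra.norm F (f.eval x) ≠ 0 := by
    intro x hx h
    have hfd : FiniteDimensional F E := Module.Finite.of_finite
    exact hx (Algebra.norm_eq_zero_iff.1 h)
  -- weighted sum
  have hw : ∀ ψ : F → ℂ, (∀ (y : F), y ≠ 0 → ∀ u : Fˣ, y ^ c = (u : F) ^ c → ψ u = ψ y) → 
      ∑ u : Fˣ, ψ u * (G u : ℂ) = (c : ℂ) * ∑ x : E, if f.eval x = 0 then 0 else ψ (Algebra.norm F (f.eval x)) := by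
    intro ψ hψ
    have h1 : ∀ u : Fˣ, ψ u * (G u : ℂ) = ∑ x : E, if (Algebra.norm F (f.eval x)) ^ c = (u : F) ^ c then ψ u else 0 := by
      intro u
      rw [← Finset.sum_filter, Finset.sum_const, nsmul_eq_mul, mul_comm]
      simp only [G, hiff]
    simp_rw [h1]
    rw [Finset.sum_comm, Finset.mul_sum]
    refine Finset.sum_congr rfl fun x _ => ?_
    split_ifs with hx
    · rw [mul_zero]
      exact Finset.sum_eq_zero fun u _ => if_neg (hzero x u hx)
    · rw [← Finset.sum_filter, Finset.sum_congr rfl (g := fun _ => ψ (Algebra.norm F (f.eval x)))]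
      · rw [Finset.sum_const, (hfib _ (hfin x hx)).1, nsmul_eq_mul]
      · intro u hu
        exact hψ _ (hfin x hx) u (Finset.mem_filter.1 hu).2
  have hwχ := hw χ (fun y hy => (hfib y hy).2)
  have hw1 := hw (fun _ => 1) (fun _ _ _ _ => rfl)
  have hSeq : (∑ x : E, if f.eval x = 0 then 0 else χ (Algebra.norm F (f.eval x))) = ∑ x : E, χ (Algebra.norm F (f.eval x)) := by
    refine Finset.sum_congr rfl fun x _ => ?_
    split_ifs with hx
    · rw [hx, Algebra.norm_zero, MulChar.map_zero]
    · rfl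
  rw [hSeq] at hwχ
  set S := ∑ x : E, χ (Algebra.norm F (f.eval x)) with hSdef
  set B : ℕ := s * (e + 3 * D + 3) with hB
  have hχsum : ∑ u : Fˣ, χ (u : F) = 0 := by
    have h1 := MulChar.sum_eq_zero_of_ne_one hχ
    rw [← h1]
    have h2 : ∑ a : F, χ a = ∑ a ∈ Finset.univ.filter (fun a : F => a ≠ 0), χ a := by
      rw [Finset.sum_filter]
      refine Finset.sum_congr rfl fun a _ => ?_
      split_ifs with h
      · rfl
      · rw [not_not.1 h, MulChar.map_zero]
    rw [h2]
    refine Finset.sum_bij (fun u _ => (u : F)) ?_ ?_ ?_ ?_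
    · intro u _; simp
    · intro a _ b _ h; exact Units.ext h
    · intro b hb; exact ⟨Units.mk0 b (by simpa using hb), Finset.mem_univ _, rfl⟩
    · intro u _; rfl
  have hcS : ‖(c : ℂ) * S‖ ≤ ∑ u : Fˣ, ((B : ℝ) - G u) := by
    have : (c : ℂ) * S = ∑ u : Fˣ, χ (u : F) * ((G u : ℂ) - B) := by
      simp_rw [mul_sub]
      rw [Finset.sum_sub_distrib, hwχ, ← Finset.sum_mul, hχsum, zero_mul, sub_zero]
    rw [this]
    refine (norm_sum_le _ _).trans (Finset.sum_le_sum fun u _ => ?_)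
    have hu : ‖χ (u : F)‖ = 1 := by
      have h4 : χ (u : F) ^ d = 1 := by
        rw [← MulChar.pow_apply_coe, hχd]; simp
      exact Complex.norm_eq_one_of_pow_eq_one h4 (by omega)
    rw [norm_mul, hu, one_mul, norm_sub_rev]
    have h5 : ((B : ℂ) - G u) = (((B - G u : ℕ) : ℝ) : ℂ) := by
      rw [Nat.cast_sub (hG u)]; push_cast; rfl
    rw [h5, Complex.norm_real, Real.norm_of_nonneg (Nat.cast_nonneg _), Nat.cast_sub (hG u)]
  -- total count
  have hsumG : (∑ u : Fˣ, G u) = c * (Finset.univ.filter (fun x : E => ¬ f.eval x = 0)).card := by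
    have : ((∑ u : Fˣ, G u : ℕ) : ℂ) = ((c * (Finset.univ.filter (fun x : E => ¬ f.eval x = 0)).card : ℕ) : ℂ) := by
      push_cast
      simp only [one_mul] at hw1
      rw [hw1, Finset.card_filter]
      push_cast
      congr 1
      refine Finset.sum_congr rfl fun x _ => ?_
      split_ifs <;> simp_all
    exact_mod_cast this
  have hz : (Finset.univ.filter (fun x : E => f.eval x = 0)).card ≤ D := by
    refine le_trans ?_ ((card_roots' f).trans hD)
    refine le_trans (Finset.card_le_card ?_) (Multiset.toFinset_card_le f.roots)
    intro x hx
    rw [Multiset.mem_toFinset, mem_roots hfne]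
    exact (Finset.mem_filter.1 hx).2
  have hnz : (s ^ 2 : ℝ) - D ≤ (Finset.univ.filter (fun x : E => ¬ f.eval x = 0)).card := by
    have h1 := Finset.card_filter_add_card_filter_not (s := (Finset.univ : Finset E)) (fun x : E => f.eval x = 0)
    rw [Finset.card_univ, hcard] at h1
    have h2 : ((s : ℝ) ^ 2) = (Finset.univ.filter (fun x : E => f.eval x = 0)).card + (Finset.univ.filter (fun x : E => ¬ f.eval x = 0)).card := by exact_mod_cast h1.symm
    have h3 : ((Finset.univ.filter (fun x : E => f.eval x = 0)).card : ℝ) ≤ D := by exact_mod_cast hz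
    linarith
  have hcR : (0 : ℝ) < c := by exact_mod_cast hc
  rw [norm_mul, Complex.norm_natCast, Finset.sum_sub_distrib, Finset.sum_const, Finset.card_univ, hcardU,
    nsmul_eq_mul, ← Nat.cast_sum, hsumG] at hcS
  push_cast at hcS
  have h6 : ‖S‖ ≤ d * B - (Finset.univ.filter (fun x : E => ¬ f.eval x = 0)).card := by
    refine le_of_mul_le_mul_left ?_ hcR
    linarith
  have h7 : (d : ℝ) * e + 1 = s := by exact_mod_cast hs
  have hs1 : (1 : ℝ) ≤ s := by rw [← h7]; nlinarith [mul_nonneg (Nat.cast_nonneg (α := ℝ) d) (Nat.cast_nonneg (α := ℝ) e)]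
  have h8 : (B : ℝ) = s * (e + 3 * D + 3) := by rw [hB]; push_cast; ring
  have h9 : (d : ℝ) * B = s * ((s - 1) + 3 * D * d + 3 * d) := by
    rw [h8, ← h7]; ring
  have hDn : (0 : ℝ) ≤ D := Nat.cast_nonneg _
  nlinarith

end

section
open Polynomial

theorem wb_weil {F : Type} [Field F] [Fintype F] [DecidableEq F] (d : ℕ) (hd : 2 ≤ d)
    (hdq : d ∣ Fintype.card F - 1) (χ : MulChar F ℂ) (hχ : orderOf χ = d) (I : Finset F) (h0 : (0 : F) ∉ I)
    (e : F → ℕ) (hg : ∀ m : ℕ, (∀ i ∈ I, d ∣ m * e i) → d ∣ m) :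
    ‖∑ x : F, χ (∏ i ∈ I, (i - x) ^ e i)‖ ≤ ((I.card - 1 : ℕ) : ℝ) * Real.sqrt (Fintype.card F) := by
  obtain ⟨i0, hi0, hχi⟩ : ∃ i0 ∈ I, χ ^ e i0 ≠ 1 := by
    by_contra hcon
    push Not at hcon
    have := hg 1 (fun i hi => by rw [one_mul, ← hχ]; exact orderOf_dvd_of_pow_eq_one (hcon i hi))
    have := Nat.le_of_dvd one_pos this
    omega
  have hei : e i0 ≠ 0 := by intro h; rw [h, pow_zero] at hχi; exact hχi rfl
  obtain ⟨t, htc, ht⟩ := wb_structure χ I e i0 hi0 hei hχi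
  have hχd : χ ^ d = 1 := by rw [← hχ]; exact pow_orderOf_eq_one χ
  have hχ1 : χ ≠ 1 := by rintro rfl; rw [orderOf_one] at hχ; omega
  obtain ⟨p, hpF⟩ := CharP.exists F
  obtain ⟨a, hp, hcardF⟩ := FiniteField.card F p
  have : Fact p.Prime := ⟨hp⟩
  set q := Fintype.card F with hq
  have hq2 : 2 ≤ q := Fintype.one_lt_card
  obtain ⟨c, hc⟩ := hdq
  have hqc : q = d * c + 1 := by omega
  set D := ∑ i ∈ I, e i with hD
  have key : ∀ m, d * (6 * D + 5) + 1 ≤ m →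
      ‖((t.map (fun α => α ^ 2)).map (fun α => α ^ m)).sum‖ ≤ (3 * D * d + 3 * d + D : ℝ) * (q : ℝ) ^ m := by
    intro m hm
    have : NeZero (2 * m) := ⟨by omega⟩
    let E := FiniteField.Extension F p (2 * m)
    have : Finite E := Module.finite_of_finite F
    letI : Fintype E := Fintype.ofFinite E
    have : CharP E p := charP_of_injective_algebraMap (algebraMap F E).injective p
    have hfr : Module.finrank F E = 2 * m := FiniteField.finrank_extension F p (2 * m)
    have hcE : Fintype.card E = (q ^ m) ^ 2 := by
      rw [Module.card_eq_pow_finrank (K := F) (V := E), hfr, ← pow_mul, mul_comm]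
    have hds : d ∣ q ^ m - 1 := by
      have h := Nat.sub_dvd_pow_sub_pow q 1 m
      rw [one_pow, hc] at h
      exact (Dvd.intro c rfl).trans h
    obtain ⟨e', he'⟩ := hds
    have hqm : m < q ^ m := (Nat.lt_pow_self (by omega))
    let f : E[X] := ∏ i ∈ I, (C (algebraMap F E i) - X) ^ e i
    have hfeval : ∀ x, f.eval x = ∏ i ∈ I, (algebraMap F E i - x) ^ e i := by
      intro x; simp [f, eval_prod]
    have hne : ∀ i : F, (C (algebraMap F E i) - X : E[X]) ≠ 0 := by
      intro i h
      have := sub_eq_zero.1 h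
      exact X_ne_C _ this.symm
    have hlin : ∀ i : F, (C (algebraMap F E i) - X : E[X]).natDegree ≤ 1 := by
      intro i
      rw [← neg_sub, natDegree_neg, natDegree_X_sub_C]
    have hdeg : f.natDegree ≤ D := by
      refine (natDegree_prod_le _ _).trans (Finset.sum_le_sum fun i _ => ?_)
      refine natDegree_pow_le.trans ?_
      nlinarith [hlin i]
    have hf0 : f.eval 0 ≠ 0 := by
      rw [hfeval, Finset.prod_ne_zero_iff]
      intro i hi
      refine pow_ne_zero _ ?_
      rw [sub_zero]
      intro h
      have : i = 0 := (map_eq_zero (algebraMap F E)).1 h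
      exact h0 (this ▸ hi)
    have hmult : ∀ i ∈ I, f.rootMultiplicity (algebraMap F E i) = e i := by
      intro i hi
      have hrest : (∏ j ∈ I.erase i, (C (algebraMap F E j) - X) ^ e j : E[X]).eval (algebraMap F E i) ≠ 0 := by
        rw [eval_prod, Finset.prod_ne_zero_iff]
        intro j hj
        rw [eval_pow]
        refine pow_ne_zero _ ?_
        rw [eval_sub, eval_C, eval_X, sub_ne_zero]
        intro h
        exact Finset.ne_of_mem_erase hj ((algebraMap F E).injective h)
      have hff : f = C ((-1) ^ e i) * ((X - C (algebraMap F E i)) ^ e i * ∏ j ∈ I.erase i, (C (algebraMap F E j) - X) ^ e j) := by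
        simp only [f]
        rw [← Finset.mul_prod_erase _ _ hi, ← mul_assoc]
        congr 1
        rw [C_pow, ← mul_pow]
        congr 1
        simp
      have hp0 : (∏ j ∈ I.erase i, (C (algebraMap F E j) - X) ^ e j : E[X]) ≠ 0 := by
        intro h; rw [h] at hrest; simp at hrest
      have hp1 : ((X - C (algebraMap F E i)) ^ e i : E[X]) ≠ 0 := pow_ne_zero _ (X_sub_C_ne_zero _)
      have hp2 : (C ((-1) ^ e i) : E[X]) ≠ 0 := by
        rw [Ne, C_eq_zero]; exact pow_ne_zero _ (neg_ne_zero.2 one_ne_zero)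
      rw [hff, rootMultiplicity_mul (mul_ne_zero hp2 (mul_ne_zero hp1 hp0)), rootMultiplicity_C,
        rootMultiplicity_mul (mul_ne_zero hp1 hp0), rootMultiplicity_X_sub_C_pow,
        rootMultiplicity_eq_zero hrest]
      omega
    have hb := wb_bound (F := F) (E := E) p (a * m) (q ^ m) d e' c D (by rw [hcardF, pow_mul]) (by omega) hd hqc
      hcE χ hχd hχ1 f hf0 (by
        intro k hk
        refine hg k fun i hi => ?_
        have := hk (algebraMap F E i)
        rwa [hmult i hi] at this) hdeg (by
        by_contra hcon
        push Not at hcon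
        have : d * e' ≤ d * (6 * D + 4) := Nat.mul_le_mul_left d hcon
        have h5 : d * (6 * D + 5) = d * (6 * D + 4) + d := by ring
        omega)
    simp_rw [hfeval] at hb
    rw [ht E, norm_neg, hfr] at hb
    rw [Multiset.map_map]
    have hfun : ((fun α : ℂ => α ^ m) ∘ fun α => α ^ 2) = fun α => α ^ (2 * m) := by
      funext α; simp [pow_mul]
    rw [hfun]
    refine hb.trans (le_of_eq ?_)
    push_cast; ring
  have hgr := wb_growth (t.map (fun α => α ^ 2)) q _ (by exact_mod_cast (by omega : 0 < q)) _ key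
  have hα : ∀ α ∈ t, ‖α‖ ≤ Real.sqrt q := by
    intro α hα
    have := hgr (α ^ 2) (Multiset.mem_map_of_mem _ hα)
    rw [norm_pow] at this
    exact Real.le_sqrt_of_sq_le this
  have h1 := ht F
  simp only [Algebra.algebraMap_self, RingHom.id_apply, Algebra.norm_self, MonoidHom.id_apply, Module.finrank_self, pow_one, Multiset.map_id'] at h1
  rw [h1, norm_neg]
  have h2 : ‖t.sum‖ ≤ t.card * Real.sqrt q := by
    have h3 := norm_multiset_sum_le t
    refine h3.trans ?_
    have h4 := Multiset.sum_le_card_nsmul (t.map (fun α => ‖α‖)) (Real.sqrt q) (by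
      intro x hx
      obtain ⟨α, h, rfl⟩ := Multiset.mem_map.1 hx
      exact hα α h)
    rwa [Multiset.card_map, nsmul_eq_mul] at h4
  refine h2.trans (mul_le_mul_of_nonneg_right (by exact_mod_cast htc) (Real.sqrt_nonneg _))

end

section
open Polynomial

theorem wb_chi1 {F : Type*} [Field F] [Fintype F] (d c : ℕ) (hd : 2 ≤ d) (hq : Fintype.card F = d * c + 1)
    (χ : MulChar F ℂ) (hχ : orderOf χ = d) (y : F) (hy : y ≠ 0) : χ y = 1 ↔ y ^ c = 1 := by
  classical
  have hc : 0 < c := by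
    rcases Nat.eq_zero_or_pos c with h | h
    · have := Fintype.one_lt_card (α := F); rw [hq, h] at this; omega
    · exact h
  have hcardU : Fintype.card Fˣ = d * c := by rw [Fintype.card_units, hq]; rfl
  obtain ⟨u, rfl⟩ : ∃ u : Fˣ, (u : F) = y := ⟨Units.mk0 y hy, rfl⟩
  have hpow : ∀ w : Fˣ, χ (w : F) ^ d = 1 := by
    intro w
    rw [← MulChar.pow_apply_coe, ← hχ, pow_orderOf_eq_one]; simp
  constructor
  · intro h
    obtain ⟨g, hg⟩ := IsCyclic.exists_generator (α := Fˣ)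
    obtain ⟨k, hk⟩ := (mem_powers_iff_mem_zpowers.2 (hg u))
    have hk' : (u : F) = (g : F) ^ k := by rw [← hk]; simp
    have h1 : χ ^ k = 1 := by
      ext w
      obtain ⟨l, hl⟩ := (mem_powers_iff_mem_zpowers.2 (hg w))
      have hl' : (w : F) = (g : F) ^ l := by rw [← hl]; simp
      rw [MulChar.pow_apply_coe, MulChar.one_apply_coe, hl', map_pow, pow_right_comm, ← map_pow χ (g : F) k, ← hk', h, one_pow]
    obtain ⟨j, rfl⟩ : d ∣ k := by rw [← hχ]; exact orderOf_dvd_of_pow_eq_one h1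
    have h2 : (g : F) ^ (d * c) = 1 := by
      have := FiniteField.pow_card_sub_one_eq_one (g : F) g.ne_zero
      rwa [hq, Nat.add_sub_cancel] at this
    rw [hk', ← pow_mul, mul_right_comm, pow_mul, h2, one_pow]
  · intro h
    obtain ⟨w, hw⟩ := wb_dth d c hc hcardU u (by ext; simpa using h)
    rw [hw, Units.val_pow_eq_pow_val, map_pow, hpow]

theorem wb_T {F : Type} [Field F] [Fintype F] (d k : ℕ)
    (hdq : d ∣ Fintype.card F - 1) (χ : MulChar F ℂ) (hχ : orderOf χ = d) (v : Fin k → F)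
    (hv : Function.Injective v) (w : F) (hw : ∀ i, v i ≠ w) (j : Fin k → ℕ) (hj : ∀ i, j i < d)
    (hj0 : ∃ i, j i ≠ 0) :
    ‖∑ x : F, ∏ i, χ (x - v i) ^ j i‖ ≤ ((k - 1 : ℕ) : ℝ) * Real.sqrt (Fintype.card F) := by
  classical
  obtain ⟨i0, hi0⟩ := hj0
  have hdpos : 0 < d := lt_of_le_of_lt (Nat.zero_le _) (hj i0)
  set g0 := Nat.gcd d (Finset.univ.gcd j) with hg0
  have hg0d : g0 ∣ d := Nat.gcd_dvd_left _ _
  have hg0j : ∀ i, g0 ∣ j i := fun i => (Nat.gcd_dvd_right _ _).trans (Finset.gcd_dvd (Finset.mem_univ i))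
  have hg0pos : 0 < g0 := Nat.pos_of_dvd_of_pos hg0d hdpos
  obtain ⟨d', hd'⟩ := hg0d
  choose e he using hg0j
  have hd'2 : 2 ≤ d' := by
    have h1 : g0 ≤ j i0 := Nat.le_of_dvd (Nat.pos_of_ne_zero hi0) ⟨e i0, he i0⟩
    have h2 := hj i0
    by_contra hcon
    have : d' ≤ 1 := by omega
    have : g0 * d' ≤ g0 * 1 := Nat.mul_le_mul_left _ this
    omega
  have hord : orderOf (χ ^ g0) = d' := by
    rw [orderOf_pow' _ hg0pos.ne', hχ, Nat.gcd_eq_right ⟨d', hd'⟩]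
    rw [Nat.div_eq_iff_eq_mul_right hg0pos ⟨d', hd'⟩]
    exact hd'
  have hinj : Function.Injective (fun i => v i - w) := fun a b h => hv (sub_left_injective h)
  let I : Finset F := Finset.univ.image (fun i => v i - w)
  have hI : I.card = k := by
    rw [Finset.card_image_of_injective _ hinj, Finset.card_univ, Fintype.card_fin]
  let e' : F → ℕ := Function.extend (fun i => v i - w) e 0
  have he' : ∀ i, e' (v i - w) = e i := fun i => hinj.extend_apply e 0 i
  have hW := wb_weil d' hd'2 ((Dvd.intro_left g0 hd'.symm).trans hdq) (χ ^ g0) hord I (by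
      simp only [I, Finset.mem_image, Finset.mem_univ, true_and, not_exists]
      intro i h
      exact hw i (sub_eq_zero.1 h)) e' (by
      intro m hm
      have h1 : ∀ i, d ∣ m * j i := by
        intro i
        have := hm (v i - w) (Finset.mem_image_of_mem _ (Finset.mem_univ i))
        rw [he'] at this
        rw [he i, hd', mul_left_comm]
        exact Nat.mul_dvd_mul_left g0 this
      have h2 : d ∣ m * g0 := by
        rw [hg0, ← Nat.gcd_mul_left]
        refine Nat.dvd_gcd (Dvd.intro_left m rfl) ?_
        have h3 : Finset.univ.gcd (fun i => m * j i) = m * Finset.univ.gcd j := by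
          rw [Finset.gcd_mul_left]; simp
        rw [← h3]
        exact Finset.dvd_gcd fun i _ => h1 i
      rw [hd', mul_comm m] at h2
      exact Nat.dvd_of_mul_dvd_mul_left hg0pos h2)
  rw [hI] at hW
  refine le_trans (le_of_eq ?_) hW
  have hsum : ∑ x : F, (χ ^ g0) (∏ i ∈ I, (i - x) ^ e' i) =
      (χ ^ g0) (∏ i, (-1) ^ e i) * ∑ x : F, ∏ i, χ (x - v i) ^ j i := by
    rw [Finset.mul_sum]
    refine Fintype.sum_bijective (fun x => x + w) (AddGroup.addRight_bijective w) _ _ ?_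
    intro x
    have h1 : ∏ i, χ (x + w - v i) ^ j i = (χ ^ g0) (∏ i, (x + w - v i) ^ e i) := by
      rw [map_prod]
      refine Finset.prod_congr rfl fun i _ => ?_
      rw [map_pow, MulChar.pow_apply' _ hg0pos.ne', ← pow_mul, ← he i]
    rw [h1, ← map_mul, ← Finset.prod_mul_distrib]
    congr 1
    rw [Finset.prod_image (fun a _ b _ h => hinj h)]
    refine Finset.prod_congr rfl fun i _ => ?_
    rw [he', ← mul_pow]
    congr 1
    ring
  rw [hsum, norm_mul]
  have hu : ‖(χ ^ g0) (∏ i, (-1) ^ e i)‖ = 1 := by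
    rw [map_prod, norm_prod]
    refine Finset.prod_eq_one fun i _ => ?_
    rw [map_pow, norm_pow]
    have h4 : (χ ^ g0) (-1) ^ 2 = 1 := by
      rw [← map_pow]; simp
    rw [Complex.norm_eq_one_of_pow_eq_one h4 two_ne_zero, one_pow]
  rw [hu, one_mul]

end

/-- Lemma 1: |M - q/d^k| ≤ k√q for solutions of (x - vᵢ)^((q-1)/d) = 1. -/
theorem stmt2 (q d k : ℕ) (hd : 2 ≤ d) (hdq : d ∣ q - 1)
    (F : Type) [Field F] [Fintype F] (hF : Fintype.card F = q)
    (v : Fin k → F) (hv : Function.Injective v) :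
    |(Nat.card {x : F | ∀ i, (x - v i) ^ ((q - 1) / d) = 1} : ℝ) - q / d ^ k|
      ≤ k * Real.sqrt q := by
  classical
  have hq2 : 2 ≤ q := by rw [← hF]; exact Fintype.one_lt_card
  obtain ⟨c, hc⟩ := hdq
  have hqc : Fintype.card F = d * c + 1 := by omega
  have hcc : (q - 1) / d = c := by rw [hc, Nat.mul_div_cancel_left _ (by omega)]
  have hcpos : 0 < c := by
    rcases Nat.eq_zero_or_pos c with h | h
    · rw [h] at hc; omega
    · exact h
  rw [hcc]
  set M : ℕ := (Finset.univ.filter (fun x : F => ∀ i, (x - v i) ^ c = 1)).card with hM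
  have hMc : Nat.card {x : F | ∀ i, (x - v i) ^ c = 1} = M := by
    rw [Nat.card_eq_fintype_card, hM, Fintype.card_subtype]
    rfl
  rw [hMc]
  have hdR : (2 : ℝ) ≤ d := by exact_mod_cast hd
  have hdkpos : (0 : ℝ) < (d : ℝ) ^ k := pow_pos (by linarith) k
  have hdk1 : (1 : ℝ) ≤ (d : ℝ) ^ k := one_le_pow₀ (by linarith)
  have hqR : (2 : ℝ) ≤ q := by exact_mod_cast hq2
  have hMq : (M : ℝ) ≤ q := by
    have : M ≤ q := by rw [hM, ← hF]; exact Finset.card_le_univ _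
    exact_mod_cast this
  have hsq : Real.sqrt q * Real.sqrt q = q := Real.mul_self_sqrt (by linarith)
  have hs0 : 0 ≤ Real.sqrt q := Real.sqrt_nonneg _
  rcases Nat.eq_zero_or_pos k with hk0 | hkpos
  · subst hk0
    have : M = q := by
      rw [hM, ← hF, ← Finset.card_univ]
      congr 1
      ext x; simp
    rw [this]; simp
  by_cases hbig : Real.sqrt q ≤ k
  · have h1 : (q : ℝ) ≤ k * Real.sqrt q := by nlinarith
    have h2 : (q : ℝ) / d ^ k ≤ q := div_le_self (by linarith) hdk1
    have h3 : 0 ≤ (q : ℝ) / d ^ k := by positivity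
    have h4 : (0 : ℝ) ≤ M := Nat.cast_nonneg _
    rw [abs_le]
    constructor <;> linarith
  push Not at hbig
  have hs1 : 1 ≤ Real.sqrt q := by rw [Real.one_le_sqrt]; linarith
  have hkq : k < q := by
    have : (k : ℝ) < q := by nlinarith
    exact_mod_cast this
  obtain ⟨w, hw⟩ : ∃ w, ∀ i, v i ≠ w := by
    by_contra hcon
    push Not at hcon
    have := Fintype.card_le_of_surjective v hcon
    rw [hF, Fintype.card_fin] at this
    omega
  have hdq' : d ∣ Fintype.card F - 1 := by rw [hF]; exact ⟨c, hc⟩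
  obtain ⟨χ, hχ⟩ := MulChar.exists_mulChar_orderOf F hdq' (Complex.isPrimitiveRoot_exp d (by omega))
  -- inner sums
  have hin : ∀ y : F, ∑ j ∈ Finset.range d, χ y ^ j =
      (if y ^ c = 1 then (d : ℂ) else 0) + (if y = 0 then 1 else 0) := by
    intro y
    by_cases hy : y = 0
    · subst hy
      rw [MulChar.map_zero, zero_pow hcpos.ne', if_neg zero_ne_one, if_pos rfl, zero_add]
      rw [Finset.sum_eq_single 0]
      · simp
      · intro b _ hb; exact zero_pow hb
      · intro h; exact absurd (Finset.mem_range.2 (by omega)) h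
    · rw [if_neg hy, add_zero]
      have h1 := wb_chi1 d c hd hqc χ hχ y hy
      split_ifs with h
      · rw [h1.2 h]; simp
      · have h2 : χ y ≠ 1 := fun h' => h (h1.1 h')
        have h3 : χ y ^ d = 1 := by
          rw [← MulChar.pow_apply' _ (by omega : d ≠ 0), ← hχ, pow_orderOf_eq_one]
          exact MulChar.one_apply (isUnit_iff_ne_zero.2 hy)
        rw [geom_sum_eq h2, h3, sub_self, zero_div]
  let P : F → ℂ := fun x => ∏ i, ∑ j ∈ Finset.range d, χ (x - v i) ^ j
  -- expansion
  let J := Fintype.piFinset (fun _ : Fin k => Finset.range d)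
  have hJ : J.card = d ^ k := by simp [J]
  have hJ0 : (0 : Fin k → ℕ) ∈ J := by
    rw [Fintype.mem_piFinset]
    intro i
    exact Finset.mem_range.2 (by simp; omega)
  have hexp : ∑ x, P x = ∑ j ∈ J, ∑ x : F, ∏ i, χ (x - v i) ^ j i := by
    simp only [P, Finset.prod_univ_sum]
    exact Finset.sum_comm
  have hB1 : ‖∑ x, P x - q‖ ≤ ((d : ℝ) ^ k - 1) * (((k : ℝ) - 1) * Real.sqrt q) := by
    have h1 : ∑ x, P x - (q : ℂ) = ∑ j ∈ J.erase 0, ∑ x : F, ∏ i, χ (x - v i) ^ j i := by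
      rw [hexp, ← Finset.add_sum_erase _ _ hJ0]
      simp [hF]
    rw [h1]
    refine (norm_sum_le _ _).trans ?_
    have h2 : ∀ j ∈ J.erase 0, ‖∑ x : F, ∏ i, χ (x - v i) ^ j i‖ ≤ ((k : ℝ) - 1) * Real.sqrt q := by
      intro j hj
      rw [Finset.mem_erase, Fintype.mem_piFinset] at hj
      have h3 := wb_T d k hdq' χ hχ v hv w hw j (fun i => Finset.mem_range.1 (hj.2 i))
        (Function.ne_iff.1 hj.1)
      rwa [hF, Nat.cast_sub hkpos, Nat.cast_one] at h3
    refine (Finset.sum_le_card_nsmul _ _ _ h2).trans (le_of_eq ?_)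
    rw [Finset.card_erase_of_mem hJ0, hJ, nsmul_eq_mul, Nat.cast_sub (Nat.one_le_pow _ _ (by omega))]
    push_cast; ring
  have hB2 : ‖∑ x, P x - (d : ℂ) ^ k * M‖ ≤ (k : ℝ) * (d : ℝ) ^ (k - 1) := by
    have h1 : (d : ℂ) ^ k * M = ∑ x : F, if ∀ i, (x - v i) ^ c = 1 then (d : ℂ) ^ k else 0 := by
      rw [← Finset.sum_filter, Finset.sum_const, nsmul_eq_mul, mul_comm]
    rw [h1, ← Finset.sum_sub_distrib]
    have h2 : ∀ x : F, ‖P x - if ∀ i, (x - v i) ^ c = 1 then (d : ℂ) ^ k else 0‖ ≤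
        ∑ i, if x = v i then (d : ℝ) ^ (k - 1) else 0 := by
      intro x
      by_cases hx : ∃ i0, x = v i0
      · obtain ⟨i0, rfl⟩ := hx
        rw [if_neg, sub_zero]
        · have h3 : (d : ℝ) ^ (k - 1) ≤ ∑ i, if v i0 = v i then (d : ℝ) ^ (k - 1) else 0 := by
            have := Finset.single_le_sum (f := fun i => if v i0 = v i then (d : ℝ) ^ (k - 1) else 0)
              (s := Finset.univ) (fun i _ => by split_ifs <;> positivity) (Finset.mem_univ i0)
            simpa using this
          refine le_trans ?_ h3
          simp only [P]
          rw [norm_prod, ← Finset.mul_prod_erase _ _ (Finset.mem_univ i0), hin, sub_self,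
            zero_pow hcpos.ne', if_neg zero_ne_one, if_pos rfl, zero_add, norm_one, one_mul]
          refine (Finset.prod_le_prod (g := fun _ => (d : ℝ)) (fun i _ => norm_nonneg _) ?_).trans (le_of_eq ?_)
          · intro i hi
            rw [hin, if_neg (t := (1 : ℂ)), add_zero]
            · split_ifs
              · simp
              · simp
            · rw [sub_eq_zero]
              intro h
              exact Finset.ne_of_mem_erase hi (hv h).symm
          · rw [Finset.prod_const, Finset.card_erase_of_mem (Finset.mem_univ _), Finset.card_univ, Fintype.card_fin]
        · intro h
          have := h i0
          rw [sub_self, zero_pow hcpos.ne'] at this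
          exact zero_ne_one this
      · push Not at hx
        have h3 : P x = if ∀ i, (x - v i) ^ c = 1 then (d : ℂ) ^ k else 0 := by
          have h4 : ∀ i, ∑ j ∈ Finset.range d, χ (x - v i) ^ j = if (x - v i) ^ c = 1 then (d : ℂ) else 0 := by
            intro i
            rw [hin, if_neg (sub_ne_zero.2 (hx i)), add_zero]
          simp only [P, h4]
          split_ifs with h
          · rw [Finset.prod_congr rfl (g := fun _ => (d : ℂ)) (fun i _ => if_pos (h i)), Finset.prod_const,
              Finset.card_univ, Fintype.card_fin]
          · push Not at h
            obtain ⟨i, hi⟩ := h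
            exact Finset.prod_eq_zero (Finset.mem_univ i) (if_neg hi)
        rw [h3, sub_self, norm_zero]
        exact Finset.sum_nonneg fun i _ => by split_ifs <;> positivity
    refine (norm_sum_le _ _).trans ((Finset.sum_le_sum fun x _ => h2 x).trans (le_of_eq ?_))
    rw [Finset.sum_comm]
    simp
  have hB3 : |(d : ℝ) ^ k * M - q| ≤ ((d : ℝ) ^ k - 1) * (((k : ℝ) - 1) * Real.sqrt q) + (k : ℝ) * (d : ℝ) ^ (k - 1) := by
    have h1 : |(d : ℝ) ^ k * M - q| = ‖((d : ℂ) ^ k * M - q)‖ := by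
      rw [← Real.norm_eq_abs, ← Complex.norm_real]; push_cast; rfl
    rw [h1]
    have h2 : ((d : ℂ) ^ k * M - q) = (∑ x, P x - q) - (∑ x, P x - (d : ℂ) ^ k * M) := by ring
    rw [h2]
    exact (norm_sub_le _ _).trans (add_le_add hB1 hB2)
  have hpk : (d : ℝ) ^ k = d * (d : ℝ) ^ (k - 1) := by
    rw [← pow_succ', Nat.sub_add_cancel hkpos]
  have hfinal : |(d : ℝ) ^ k * M - q| ≤ (d : ℝ) ^ k * (k * Real.sqrt q) := by
    refine hB3.trans ?_
    have hk1 : (1 : ℝ) ≤ k := by exact_mod_cast hkpos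
    have h5 : (k : ℝ) * (d : ℝ) ^ (k - 1) ≤ (d : ℝ) ^ k * Real.sqrt q := by
      rw [hpk]
      have h6 : (0 : ℝ) ≤ (d : ℝ) ^ (k - 1) := by positivity
      have h7 : (k : ℝ) ≤ d * Real.sqrt q := by nlinarith
      nlinarith
    have h8 : 0 ≤ ((k : ℝ) - 1) * Real.sqrt q := mul_nonneg (by linarith) hs0
    nlinarith
  have hrew : (M : ℝ) - q / d ^ k = ((d : ℝ) ^ k * M - q) / d ^ k := by
    field_simp
  rw [hrew, abs_div, abs_of_pos hdkpos, div_le_iff₀ hdkpos]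
  linarith
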